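/- Let φ:X→ℝ be the potential constructed in the main theorem for a strictly increasing sequence (β_n) in [α,∞) with lim_{n→∞}β_n=β_∞<∞. Then for every β>β_∞ the set of equilibrium states of βφ equals {tμ_x+(1−t)μ_y : t∈[0,1]}, where μ_x and μ_y are the Dirac point masses at the two fixed points x=(…000…) and y=(…111…) of the shift; in particular the family of equilibrium states of βφ is constant for all β>β_∞. -/

import Mathlib

open MeasureTheory Real Filter Topology

noncomputable section

namespace PhaseTransitions

/-! ### Measure-theoretic entropy and topological pressure -/

/-- Base-2 entropy of the (finite, measurable) partition of `X` induced by an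
observable `f : X → F` with finitely many values. -/
def entOfObs {X F : Type*} [MeasurableSpace X] [Fintype F]
    (μ : Measure X) (f : X → F) : ℝ :=
  ∑ a : F, -((μ (f ⁻¹' {a})).toReal * Real.logb 2 (μ (f ⁻¹' {a})).toReal)

/-- Entropy of the transformation `T` with respect to the partition induced by
the observable `f` : the limit (= infimum) of `(1/n) H(⋁_{i<n} T⁻ⁱ f)`. -/
def entObsT {X F : Type*} [MeasurableSpace X] [Fintype F]
    (T : X → X) (μ : Measure X) (f : X → F) : ℝ :=
  ⨅ n : ℕ, entOfObs μ (fun x => fun i : Fin (n + 1) => f (T^[(i : ℕ)] x)) / (n + 1)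

/-- Kolmogorov–Sinai (measure-theoretic) entropy, base 2: supremum over all
finite measurable partitions (encoded by observables with values in `Fin k`). -/
def kolSinai {X : Type*} [MeasurableSpace X] (T : X → X) (μ : Measure X) : ℝ :=
  ⨆ k : ℕ, ⨆ f : {f : X → Fin k // Measurable f}, entObsT T μ f.1

/-- `μ` is a `T`-invariant Borel probability measure. -/
def InvProb {X : Type*} [MeasurableSpace X] (T : X → X) (μ : Measure X) : Prop :=
  IsProbabilityMeasure μ ∧ MeasurePreserving T μ μ

/-- Topological pressure, via the variational principle. -/
def pressure {X : Type*} [MeasurableSpace X] (T : X → X) (φ : X → ℝ) : ℝ :=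
  ⨆ μ : {μ : Measure X // InvProb T μ}, (kolSinai T μ.1 + ∫ x, φ x ∂μ.1)

/-- An equilibrium state of the potential `φ`: an invariant probability measure
attaining the supremum in the variational principle. -/
def IsEquilibrium {X : Type*} [MeasurableSpace X] (T : X → X) (φ : X → ℝ)
    (μ : Measure X) : Prop :=
  InvProb T μ ∧ kolSinai T μ + ∫ x, φ x ∂μ = pressure T φ

/-! ### The two-sided full shift on two symbols -/

/-- The two-sided full shift space `{0,1}^ℤ`. -/
abbrev Bin : Type := ℤ → Bool

/-- The (left) shift map. -/
def shift (x : Bin) : Bin := fun n => x (n + 1)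

/-- `x` is a bi-infinite free concatenation of words from `W`: there is a
bi-infinite increasing sequence of cut points, cofinal in both directions, such
that consecutive cut points delimit words of `W`. -/
def IsFreeConcat (W : Set (List Bool)) (x : Bin) : Prop :=
  ∃ t : ℤ → ℤ, StrictMono t ∧ (∀ N : ℤ, ∃ k, N < t k) ∧ (∀ N : ℤ, ∃ k, t k < N) ∧
    ∀ k : ℤ, ∃ w ∈ W, t (k + 1) = t k + w.length ∧
      ∀ (i : ℕ) (h : i < w.length), x (t k + (i : ℤ)) = w.get ⟨i, h⟩

/-- The coded system generated by the word set `W`: the closure of the set of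
free concatenations of words from `W`. -/
def codedSystem (W : Set (List Bool)) : Set Bin :=
  closure {x | IsFreeConcat W x}

/-- The generating set `W_n = {0^{2^n-1}1, 1^{2^n-1}0}`. -/
def genWords (n : ℕ) : Set (List Bool) :=
  {List.replicate (2 ^ n - 1) false ++ [true], List.replicate (2 ^ n - 1) true ++ [false]}

/-- The subshift `X_n`, the coded system generated by `W_n`. -/
def Xsub (n : ℕ) : Set Bin := codedSystem (genWords n)

/-- The set of words of length `j` in the language of `Y ⊆ {0,1}^ℤ`. -/
def langWord (Y : Set Bin) (j : ℕ) : Set (Fin j → Bool) :=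
  {w | ∃ x ∈ Y, ∀ i : Fin j, x ((i : ℕ) : ℤ) = w i}

/-! ### The metric and the potential -/

open Classical in
/-- The metric `d(x,y) = 2^{-inf{|n| : x_n ≠ y_n}}` on the shift space. -/
def binDist (x y : Bin) : ℝ :=
  if x = y then 0
  else (1 / 2 : ℝ) ^ sInf {m : ℕ | ∃ i : ℤ, i.natAbs = m ∧ x i ≠ y i}

/-- Distance from a point to a set. -/
def distToSet (x : Bin) (S : Set Bin) : ℝ :=
  sInf ((fun y => binDist x y) '' S)

/-- `δ_j = (10 + 3 log₂ j)/(α j)`. -/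
def deltaSeq (α : ℝ) (j : ℕ) : ℝ := (10 + 3 * Real.logb 2 j) / (α * j)

/-- The drop `δ` as a function of the distance `r`: if `r = 2^{-j}` this equals
`δ_j = (10 + 3 log₂ j)/(α j)`, and `δ = 0` when `r = 0` (i.e. `δ_∞ = 0`). -/
def deltaOf (α : ℝ) (r : ℝ) : ℝ :=
  if r = 0 then 0
  else (10 + 3 * Real.logb 2 (-Real.logb 2 r)) / (α * (-Real.logb 2 r))

/-- `c_n = -∑_{j=n}^∞ 1/(2^{j+1} β_j)`. -/
def cseq (β : ℕ → ℝ) (n : ℕ) : ℝ :=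
  -∑' k : ℕ, 1 / (2 ^ (n + k + 1) * β (n + k))

/-- `φ_n(x) = c_n − δ_j` when `dist(x, X_n) = 2^{-j}` (and `φ_n = c_n` on `X_n`). -/
def phiN (α : ℝ) (c : ℕ → ℝ) (n : ℕ) (x : Bin) : ℝ :=
  c n - deltaOf α (distToSet x (Xsub n))

/-- The potential `φ = sup_{n ≥ 1} φ_n`. -/
def phi (α : ℝ) (c : ℕ → ℝ) (x : Bin) : ℝ :=
  ⨆ n : ℕ, phiN α c (n + 1) x

/-- The constants of the finite (truncated) construction:
`c_{n} = c_1 + ∑_{j=1}^{n-1} 1/(2^{j+1} β_j)`. -/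
def cseqFin (c1 : ℝ) (β : ℕ → ℝ) (n : ℕ) : ℝ :=
  c1 + ∑ j ∈ Finset.Ico 1 n, 1 / (2 ^ (j + 1) * β j)

/-- The truncated potential `φ = max{φ_n : 1 ≤ n ≤ N+1}`. -/
def phiFin (α : ℝ) (c : ℕ → ℝ) (N : ℕ) (x : Bin) : ℝ :=
  ⨆ n : Fin (N + 1), phiN α c ((n : ℕ) + 1) x

/-! ### Measures of maximal entropy and relative pressure -/

/-- `μ` is a measure of maximal entropy for the subsystem `Y` (a `T`-invariant
probability measure giving full mass to `Y` and maximizing entropy among such). -/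
def IsMaxEntropyOn (Y : Set Bin) (μ : Measure Bin) : Prop :=
  InvProb shift μ ∧ μ Y = 1 ∧
    ∀ ν : Measure Bin, InvProb shift ν → ν Y = 1 → kolSinai shift ν ≤ kolSinai shift μ

/-- The topological pressure of the subsystem `Y` (computed via the variational
principle over invariant measures giving full mass to `Y`). -/
def pressureOn (Y : Set Bin) (φ : Bin → ℝ) : ℝ :=
  ⨆ μ : {μ : Measure Bin // InvProb shift μ ∧ μ Y = 1},
    (kolSinai shift μ.1 + ∫ x, φ x ∂μ.1)

/-! ### The pin-sequence space -/

/-- `Y`, the closure of the union of the `X_n`, `n ≥ 1`. -/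
def Yset : Set Bin := closure (⋃ n : ℕ, Xsub (n + 1))

/-- The word `x_i ⋯ x_j` belongs to the language of `Y`. -/
def SegIn (x : Bin) (i j : ℤ) (Y : Set Bin) : Prop :=
  ∃ y ∈ Y, ∀ m : ℤ, i ≤ m → m ≤ j → y (m - i) = x m

/-- The word `x_0 ⋯ x_{j-1}` belongs to the language of `Y`. -/
def WordIn (x : Bin) (j : ℕ) (Y : Set Bin) : Prop :=
  ∃ y ∈ Y, ∀ m : ℕ, m < j → y (m : ℤ) = x (m : ℤ)

/-- The pin-sequence space `P ⊆ X × {0,1}^ℤ`: pinless stretches of `x` lie in the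
language of `Y`, and stretches between two pins do not. -/
def PinSpace : Set (Bin × Bin) :=
  {p | (∀ i j : ℤ, i < j → (∀ k : ℤ, i < k → k ≤ j → p.2 k = false) → SegIn p.1 i j Yset) ∧
       (∀ i j : ℤ, i < j → p.2 i = true → p.2 j = true → ¬ SegIn p.1 i j Yset)}

/-- The product shift `T̄(x,z) = (Tx, Tz)`. -/
def shift2 (p : Bin × Bin) : Bin × Bin := (shift p.1, shift p.2)

/-- The set `A = {(x,z) ∈ P : z_0 = 1}`. -/
def Aset : Set (Bin × Bin) := {p | p ∈ PinSpace ∧ p.2 0 = true}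

/-- The first return time to `A`. -/
def retTime (p : Bin × Bin) : ℕ :=
  sInf {k : ℕ | 1 ≤ k ∧ shift2^[k] p ∈ Aset}

/-- The induced (first-return) map `T̄_A`. -/
def inducedMap (p : Bin × Bin) : Bin × Bin := shift2^[retTime p] p

/-- `Q_j`, the set of points of `A` with first return time `j`. -/
def Qset (j : ℕ) : Set (Bin × Bin) := {p | p ∈ Aset ∧ retTime p = j}

/-- `Q_{j,s}` for `1 ≤ s ≤ ⌊log₂ j⌋ - 3`: points of `Q_j` whose initial block of
length `j` lies in the language of `X_s`; the class `s = 0` collects the blocks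
belonging to some `X_{s'}` with `s' ≥ ⌊log₂ j⌋ - 2`. -/
def Qjs (j s : ℕ) : Set (Bin × Bin) :=
  if s = 0 then
    {p | p ∈ Qset j ∧ ∃ s' : ℕ, 1 ≤ s' ∧ Nat.log 2 j - 2 ≤ s' ∧ WordIn p.1 j (Xsub s')}
  else {p | p ∈ Qset j ∧ WordIn p.1 j (Xsub s)}

/-! ### Words of the coded systems -/

/-- Along the first `j` letters of `y`, the letter changes at the positions `≡ c` mod `2^n`,
may or may not change at the positions `≡ c + 1`, and does not change elsewhere. -/
def Matches (n : ℕ) (c : ℤ) (y : ℕ → Bool) (j : ℕ) : Prop :=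
  ∀ i : ℕ, i + 1 < j →
    ((2 : ℤ) ^ n ∣ i - c → y i ≠ y (i + 1)) ∧
    (¬ (2 : ℤ) ^ n ∣ i - c → ¬ (2 : ℤ) ^ n ∣ i - c - 1 → y i = y (i + 1))

/-- The word `y_0 ⋯ y_{j-1}` has the local structure of a word of `X_n`. -/
def InLang (n : ℕ) (y : ℕ → Bool) (j : ℕ) : Prop := ∃ c, Matches n c y j

lemma Matches.congr {n : ℕ} {c : ℤ} {y z : ℕ → Bool} {j : ℕ} (h : Matches n c y j)
    (hyz : ∀ i < j, y i = z i) : Matches n c z j := by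
  intro i hi
  rw [← hyz i (by omega), ← hyz (i + 1) hi]
  exact h i hi

lemma InLang.congr {n : ℕ} {y z : ℕ → Bool} {j : ℕ} (h : InLang n y j)
    (hyz : ∀ i < j, y i = z i) : InLang n z j := by
  obtain ⟨c, hc⟩ := h
  exact ⟨c, hc.congr hyz⟩

lemma inLang_congr {n : ℕ} {y z : ℕ → Bool} {j : ℕ} (hyz : ∀ i < j, y i = z i) :
    InLang n y j ↔ InLang n z j :=
  ⟨fun h => h.congr hyz, fun h => h.congr fun i hi => (hyz i hi).symm⟩

lemma InLang.subword {n : ℕ} {y z : ℕ → Bool} {j k a : ℕ} (h : InLang n y j)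
    (hk : a + k ≤ j) (hz : ∀ i < k, z i = y (a + i)) : InLang n z k := by
  obtain ⟨c, hc⟩ := h
  refine ⟨c - a, fun i hi => ?_⟩
  have h1 := hc (a + i) (by omega)
  rw [hz i (by omega), hz (i + 1) hi]
  have e : ((a + i : ℕ) : ℤ) - c = i - (c - a) := by push_cast; ring
  rw [e] at h1
  simpa [add_assoc] using h1

lemma inLang_one (n : ℕ) (y : ℕ → Bool) : InLang n y 1 := ⟨0, fun i hi => by omega⟩

lemma exists_dvd_sub_lt (q : ℕ) (hq : 0 < q) (c : ℤ) : ∃ i : ℕ, i < q ∧ (q : ℤ) ∣ i - c := by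
  refine ⟨(c % q).toNat, ?_, ?_⟩
  · have := Int.emod_lt_of_pos c (by exact_mod_cast hq : (0 : ℤ) < q)
    have := Int.emod_nonneg c (by exact_mod_cast hq.ne' : (q : ℤ) ≠ 0)
    omega
  · rw [Int.toNat_of_nonneg (Int.emod_nonneg c (by exact_mod_cast hq.ne'))]
    exact (Int.dvd_iff_emod_eq_zero).2 (by simp)

/-- In a word of `X_n` shorter than its period, letter changes are adjacent. -/
lemma Matches.dvd_of_ne {n : ℕ} {c : ℤ} {y : ℕ → Bool} {j i : ℕ} (h : Matches n c y j)
    (hi : i + 1 < j) (hne : y i ≠ y (i + 1)) :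
    (2 : ℤ) ^ n ∣ i - c ∨ (2 : ℤ) ^ n ∣ i - c - 1 := by
  by_contra! hcon
  exact hne ((h i hi).2 hcon.1 hcon.2)

lemma InLang.dvd_of_ne_of_ne {n : ℕ} {y : ℕ → Bool} {j a b : ℕ} (h : InLang n y j)
    (ha : a + 1 < j) (hb : b + 1 < j) (hya : y a ≠ y (a + 1)) (hyb : y b ≠ y (b + 1)) :
    (2 : ℤ) ^ n ∣ b - a ∨ (2 : ℤ) ^ n ∣ b - a - 1 ∨ (2 : ℤ) ^ n ∣ b - a + 1 := by
  obtain ⟨c, hc⟩ := h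
  rcases hc.dvd_of_ne ha hya with h1 | h1 <;> rcases hc.dvd_of_ne hb hyb with h2 | h2 <;>
    have h3 := dvd_sub h2 h1
  · exact Or.inl (h3.trans (dvd_of_eq (by ring)))
  · exact Or.inr (Or.inl (h3.trans (dvd_of_eq (by ring))))
  · exact Or.inr (Or.inr (h3.trans (dvd_of_eq (by ring))))
  · exact Or.inl (h3.trans (dvd_of_eq (by ring)))

lemma not_inLang_of_lt {s n : ℕ} (hs : 1 ≤ s) (hsn : s < n) {y : ℕ → Bool}
    (h1 : InLang s y (2 * 2 ^ s + 1)) : ¬ InLang n y (2 * 2 ^ s + 1) := by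
  intro h2
  obtain ⟨c, hc⟩ := h1
  obtain ⟨i, hi, hd⟩ := exists_dvd_sub_lt (2 ^ s) (by positivity) c
  push_cast at hd
  have n1 := (hc i (by omega)).1 hd
  have n2 := (hc (i + 2 ^ s) (by omega)).1
    ((dvd_add hd (dvd_refl ((2 : ℤ) ^ s))).trans (dvd_of_eq (by push_cast; ring)))
  have h3 := h2.dvd_of_ne_of_ne (by omega) (by omega) n1 n2
  have hq : (2 : ℤ) ≤ 2 ^ s := by
    calc (2 : ℤ) = 2 ^ 1 := by norm_num
      _ ≤ 2 ^ s := pow_le_pow_right₀ (by norm_num) hs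
  have hq' : (2 : ℤ) * 2 ^ s ≤ 2 ^ n := by
    rw [← pow_succ']; exact pow_le_pow_right₀ (by norm_num) hsn
  have e : (((i + 2 ^ s : ℕ) : ℤ) - i) = 2 ^ s := by push_cast; ring
  rw [e] at h3
  rcases h3 with h3 | h3 | h3 <;> have := Int.le_of_dvd (by omega) h3 <;> omega

lemma InLang.of_le {m n j : ℕ} (hj : j < 2 ^ m) (hmn : m ≤ n) {y : ℕ → Bool}
    (h : InLang n y j) : InLang m y j := by
  obtain ⟨c, hc⟩ := h
  have hp : (2 : ℤ) ^ m ≤ 2 ^ n := pow_le_pow_right₀ (by norm_num) hmn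
  have hj' : (j : ℤ) < 2 ^ m := by exact_mod_cast hj
  have key : ∀ q : ℤ, (j : ℤ) < q → ∀ e : ℤ, -1 ≤ e → e ≤ j - 1 → ∀ i : ℤ, 0 ≤ i → i + 1 < j →
      ((q ∣ i - e ↔ i = e) ∧ (q ∣ i - e - 1 ↔ i = e + 1)) := by
    intro q hq e he1 he2 i hi1 hi2
    refine ⟨⟨fun h => ?_, fun h => by simp [h]⟩, ⟨fun h => ?_, fun h => by simp [h]⟩⟩
    · have := Int.eq_zero_of_abs_lt_dvd h (by rw [abs_lt]; constructor <;> omega)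
      omega
    · have := Int.eq_zero_of_abs_lt_dvd h (by rw [abs_lt]; constructor <;> omega)
      omega
  obtain ⟨r, hr, hd⟩ := exists_dvd_sub_lt (2 ^ n) (by positivity) (c + 1)
  push_cast at hd
  have hr' : (r : ℤ) < 2 ^ n := by exact_mod_cast hr
  have hshift : ∀ i : ℤ, ((2 : ℤ) ^ n ∣ i - c ↔ (2 : ℤ) ^ n ∣ i - (r - 1)) ∧
      ((2 : ℤ) ^ n ∣ i - c - 1 ↔ (2 : ℤ) ^ n ∣ i - (r - 1) - 1) := by
    intro i
    exact ⟨dvd_iff_dvd_of_dvd_sub (hd.trans (dvd_of_eq (by ring))),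
      dvd_iff_dvd_of_dvd_sub (hd.trans (dvd_of_eq (by ring)))⟩
  by_cases hrj : r ≤ j
  · refine ⟨r - 1, fun i hi => ?_⟩
    have h1 := hc i hi
    have k1 := key _ (hj'.trans_le hp) (r - 1) (by omega) (by omega) i (by omega) (by omega)
    have k2 := key _ hj' (r - 1) (by omega) (by omega) i (by omega) (by omega)
    rw [(hshift i).1, (hshift i).2, k1.1, k1.2] at h1
    rwa [k2.1, k2.2]
  · refine ⟨j - 1, fun i hi => ?_⟩
    have h1 := hc i hi
    have k2 := key _ hj' (j - 1) (by omega) (by omega) i (by omega) (by omega)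
    rw [k2.1, k2.2]
    refine ⟨fun h => by omega, fun _ _ => h1.2 ?_ ?_⟩
    · rw [(hshift i).1]
      intro h
      have := Int.eq_zero_of_abs_lt_dvd h (by rw [abs_lt]; constructor <;> omega)
      omega
    · rw [(hshift i).2]
      intro h
      have := Int.eq_zero_of_abs_lt_dvd h (by rw [abs_lt]; constructor <;> omega)
      omega

/-! ### Sums over words -/

/-- Extension of a finite word by `false`. -/
def extWord {N : ℕ} (w : Fin N → Bool) (i : ℕ) : Bool := if h : i < N then w ⟨i, h⟩ else false

/-- Sum of `F` over all words of length `N`. -/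
def wordSum (N : ℕ) (F : (ℕ → Bool) → ℝ) : ℝ := ∑ w : Fin N → Bool, F (extWord w)

lemma extWord_append_left {j m : ℕ} (u : Fin j → Bool) (v : Fin m → Bool) {i : ℕ} (hi : i < j) :
    extWord (Fin.append u v) i = extWord u i := by
  have : (⟨i, by omega⟩ : Fin (j + m)) = Fin.castAdd m ⟨i, hi⟩ := rfl
  simp only [extWord, hi, dif_pos, show i < j + m by omega]
  rw [this, Fin.append_left]

lemma extWord_append_right {j m : ℕ} (u : Fin j → Bool) (v : Fin m → Bool) :
    (fun i => extWord (Fin.append u v) (j + i)) = extWord v := by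
  funext i
  by_cases hi : i < m
  · have : (⟨j + i, by omega⟩ : Fin (j + m)) = Fin.natAdd j ⟨i, hi⟩ := rfl
    simp only [extWord, hi, dif_pos, show j + i < j + m by omega]
    rw [this, Fin.append_right]
  · simp [extWord, hi]

lemma wordSum_mul {j m : ℕ} (F H : (ℕ → Bool) → ℝ)
    (hF : ∀ y z : ℕ → Bool, (∀ i < j, y i = z i) → F y = F z) :
    wordSum (j + m) (fun y => F y * H (fun i => y (j + i))) = wordSum j F * wordSum m H := by
  unfold wordSum
  rw [← (Fin.appendEquiv j m).sum_comp, Fintype.sum_prod_type, Finset.sum_mul_sum]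
  refine Finset.sum_congr rfl fun u _ => Finset.sum_congr rfl fun v _ => ?_
  have h1 : F (extWord (Fin.append u v)) = F (extWord u) :=
    hF _ _ fun i hi => extWord_append_left u v hi
  simp only [Fin.appendEquiv, Equiv.coe_fn_mk]
  rw [h1, extWord_append_right]

lemma wordSum_finset_sum {ι : Type*} (s : Finset ι) (N : ℕ) (F : ι → (ℕ → Bool) → ℝ) :
    wordSum N (fun y => ∑ i ∈ s, F i y) = ∑ i ∈ s, wordSum N (F i) := Finset.sum_comm

lemma wordSum_const_mul (N : ℕ) (a : ℝ) (F : (ℕ → Bool) → ℝ) :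
    wordSum N (fun y => a * F y) = a * wordSum N F := by
  simp [wordSum, Finset.mul_sum]

lemma wordSum_add (N : ℕ) (F H : (ℕ → Bool) → ℝ) :
    wordSum N (fun y => F y + H y) = wordSum N F + wordSum N H := Finset.sum_add_distrib

open Classical in
lemma card_matches_le (n j : ℕ) (c : ℤ) :
    (Finset.univ.filter fun w : Fin j → Bool => Matches n c (extWord w) j).card ≤
      2 * 2 ^ (j / 2 ^ n + 1) := by
  obtain ⟨r, hr, hd⟩ := exists_dvd_sub_lt (2 ^ n) (by positivity) (c + 1)
  push_cast at hd
  set q := 2 ^ n with hq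
  have hcard : (Finset.univ : Finset (Bool × (Fin (j / q + 1) → Bool))).card
      = 2 * 2 ^ (j / q + 1) := by simp
  rw [← hcard]
  refine Finset.card_le_card_of_injOn
    (fun w => (extWord w 0, fun k => extWord w (r + k * q + 1))) (fun _ _ => Finset.mem_univ _) ?_
  intro w hw w' hw' heq
  simp only [Finset.coe_filter, Finset.mem_univ, true_and, Set.mem_ofPred_eq] at hw hw'
  simp only [Prod.mk.injEq] at heq
  obtain ⟨h0, hfree⟩ := heq
  have key : ∀ i, i < j → extWord w i = extWord w' i := by
    intro i
    induction i with
    | zero => intro _; exact h0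
    | succ i ih =>
      intro hi
      have e := ih (by omega)
      by_cases h1 : (2 : ℤ) ^ n ∣ i - c - 1
      · have h2 : ((q : ℕ) : ℤ) ∣ i - r := by
          rw [hq]; push_cast
          exact (dvd_sub h1 hd).trans (dvd_of_eq (by ring))
        have hk : ∃ k : ℕ, i = r + k * q := by
          obtain ⟨k, hk⟩ := h2
          have hk0 : 0 ≤ k := by
            by_contra hneg
            have : (q : ℤ) * k ≤ (q : ℤ) * (-1) :=
              mul_le_mul_of_nonneg_left (by omega) (by positivity)
            have hr' : (r : ℤ) < q := by exact_mod_cast hr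
            omega
          refine ⟨k.toNat, ?_⟩
          zify
          rw [Int.toNat_of_nonneg hk0]
          linarith
        obtain ⟨k, rfl⟩ := hk
        have hkj : k < j / q + 1 := by
          rw [Nat.lt_succ_iff, Nat.le_div_iff_mul_le (by positivity)]
          omega
        exact congrFun hfree ⟨k, hkj⟩
      · by_cases h2 : (2 : ℤ) ^ n ∣ i - c
        · have a1 := (hw i hi).1 h2
          have a2 := (hw' i hi).1 h2
          rw [e] at a1
          revert a1 a2
          cases extWord w' i <;> cases extWord w (i + 1) <;> cases extWord w' (i + 1) <;> simp
        · rw [← (hw i hi).2 h2 h1, ← (hw' i hi).2 h2 h1, e]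
  funext i
  have := key i i.2
  simpa [extWord] using this

open Classical in
lemma card_inLang_le (n j : ℕ) :
    (Finset.univ.filter fun w : Fin j → Bool => InLang n (extWord w) j).card ≤
      2 ^ n * (2 * 2 ^ (j / 2 ^ n + 1)) := by
  have hsub : (Finset.univ.filter fun w : Fin j → Bool => InLang n (extWord w) j) ⊆
      (Finset.range (2 ^ n)).biUnion fun c =>
        Finset.univ.filter fun w : Fin j → Bool => Matches n (c : ℤ) (extWord w) j := by
    intro w hw
    simp only [Finset.mem_filter, Finset.mem_univ, true_and, Finset.mem_biUnion,
      Finset.mem_range] at hw ⊢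
    obtain ⟨c, hc⟩ := hw
    obtain ⟨r, hr, hd⟩ := exists_dvd_sub_lt (2 ^ n) (by positivity) c
    push_cast at hd
    refine ⟨r, hr, fun i hi => ?_⟩
    have h1 : (2 : ℤ) ^ n ∣ i - c ↔ (2 : ℤ) ^ n ∣ i - r :=
      dvd_iff_dvd_of_dvd_sub (hd.trans (dvd_of_eq (by ring)))
    have h2 : (2 : ℤ) ^ n ∣ i - c - 1 ↔ (2 : ℤ) ^ n ∣ i - r - 1 :=
      dvd_iff_dvd_of_dvd_sub (hd.trans (dvd_of_eq (by ring)))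
    rw [← h1, ← h2]
    exact hc i hi
  refine (Finset.card_le_card hsub).trans (Finset.card_biUnion_le.trans ?_)
  refine (Finset.sum_le_sum fun (c : ℕ) _ => card_matches_le n j (c : ℤ)).trans ?_
  simp

open Classical in
/-- Weight of the word `y_0 ⋯ y_{j-1}`, regarded as a block of the parsing. -/
def blockWeight (j : ℕ) (y : ℕ → Bool) : ℝ :=
  ∑ n ∈ Finset.Icc 1 (Nat.log 2 j + 1),
    if InLang n y j then 16 * (2 : ℝ) ^ (-((j : ℝ) / 2 ^ n)) else 0

lemma blockWeight_nonneg (j : ℕ) (y : ℕ → Bool) : 0 ≤ blockWeight j y := by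
  unfold blockWeight
  refine Finset.sum_nonneg fun n _ => ?_
  split_ifs <;> positivity

lemma blockWeight_congr {j : ℕ} {y z : ℕ → Bool} (h : ∀ i < j, y i = z i) :
    blockWeight j y = blockWeight j z := by
  unfold blockWeight
  refine Finset.sum_congr rfl fun n _ => ?_
  rw [inLang_congr h]

lemma wordSum_blockWeight_le {j : ℕ} (hj : 1 ≤ j) : wordSum j (blockWeight j) ≤ 256 * j := by
  classical
  unfold blockWeight
  rw [wordSum_finset_sum]
  have h1 : ∀ n ∈ Finset.Icc 1 (Nat.log 2 j + 1), wordSum j (fun y => if InLang n y j then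
      16 * (2 : ℝ) ^ (-((j : ℝ) / 2 ^ n)) else 0) ≤ 64 * 2 ^ n := by
    intro n _
    unfold wordSum
    rw [← Finset.sum_filter, Finset.sum_const, nsmul_eq_mul]
    have hc : (((Finset.univ.filter fun w : Fin j → Bool => InLang n (extWord w) j).card : ℕ) : ℝ)
        ≤ 2 ^ n * (2 * 2 ^ (j / 2 ^ n + 1)) := by exact_mod_cast card_inLang_le n j
    have hp : (2 : ℝ) ^ (j / 2 ^ n) * (2 : ℝ) ^ (-((j : ℝ) / 2 ^ n)) ≤ 1 := by
      rw [← Real.rpow_natCast, ← Real.rpow_add (by norm_num)]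
      refine Real.rpow_le_one_of_one_le_of_nonpos (by norm_num) ?_
      have : ((j / 2 ^ n : ℕ) : ℝ) ≤ (j : ℝ) / ((2 ^ n : ℕ) : ℝ) := Nat.cast_div_le
      push_cast at this ⊢
      linarith
    calc _ ≤ 2 ^ n * (2 * 2 ^ (j / 2 ^ n + 1)) * (16 * (2 : ℝ) ^ (-((j : ℝ) / 2 ^ n))) := by
          gcongr
      _ = 64 * 2 ^ n * (2 ^ (j / 2 ^ n) * (2 : ℝ) ^ (-((j : ℝ) / 2 ^ n))) := by ring
      _ ≤ 64 * 2 ^ n * 1 := by gcongr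
      _ = _ := by ring
  refine (Finset.sum_le_sum h1).trans ?_
  rw [← Finset.mul_sum]
  have h2 : ∑ n ∈ Finset.Icc 1 (Nat.log 2 j + 1), (2 : ℝ) ^ n ≤ 2 ^ (Nat.log 2 j + 2) := by
    have h3 : ∑ n ∈ Finset.Icc 1 (Nat.log 2 j + 1), (2 : ℝ) ^ n
        ≤ ∑ n ∈ Finset.range (Nat.log 2 j + 2), (2 : ℝ) ^ n := by
      refine Finset.sum_le_sum_of_subset_of_nonneg ?_ fun _ _ _ => by positivity
      intro n hn
      simp only [Finset.mem_Icc, Finset.mem_range] at hn ⊢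
      omega
    rw [geom_sum_eq (by norm_num)] at h3
    norm_num at h3 ⊢
    linarith
  have h4 : (2 : ℝ) ^ Nat.log 2 j ≤ j := by exact_mod_cast Nat.pow_log_le_self 2 (by omega)
  rw [pow_add] at h2
  linarith

/-- Sum over all parsings of `y_0 ⋯ y_{N-1}` of the product of the weights of the blocks. -/
def parseWeight (N : ℕ) (y : ℕ → Bool) : ℝ :=
  blockWeight N y + ∑ j ∈ (Finset.Ico 1 N).attach,
    (blockWeight j y * (1 / (2 ^ 10 * (j : ℝ) ^ 3))) *
      parseWeight (N - j) (fun i => y (j + i))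
termination_by N
decreasing_by
  have := Finset.mem_Ico.1 j.2
  omega

lemma parseWeight_eq (N : ℕ) (y : ℕ → Bool) : parseWeight N y =
    blockWeight N y + ∑ j ∈ Finset.Ico 1 N, (blockWeight j y * (1 / (2 ^ 10 * (j : ℝ) ^ 3))) *
      parseWeight (N - j) (fun i => y (j + i)) := by
  rw [parseWeight, Finset.sum_attach (Finset.Ico 1 N) (fun j =>
    (blockWeight j y * (1 / (2 ^ 10 * (j : ℝ) ^ 3))) * parseWeight (N - j) (fun i => y (j + i)))]

lemma parseWeight_nonneg (N : ℕ) : ∀ y, 0 ≤ parseWeight N y := by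
  induction N using Nat.strong_induction_on with
  | _ N ih =>
    intro y
    rw [parseWeight_eq]
    refine add_nonneg (blockWeight_nonneg _ _) (Finset.sum_nonneg fun j hj => ?_)
    have hj' := Finset.mem_Ico.1 hj
    exact mul_nonneg (mul_nonneg (blockWeight_nonneg _ _) (by positivity)) (ih _ (by omega) _)

lemma sum_inv_sq_le (N : ℕ) : ∑ j ∈ Finset.Ico 1 N, 1 / (j : ℝ) ^ 2 ≤ 2 := by
  have h : ∀ N : ℕ, ∑ j ∈ Finset.Ico 1 (N + 2), 1 / (j : ℝ) ^ 2 ≤ 2 - 1 / ((N : ℝ) + 1) := by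
    intro N
    induction N with
    | zero => norm_num
    | succ N ih =>
      rw [Finset.sum_Ico_succ_top (by omega)]
      have : 1 / (((N + 2 : ℕ) : ℝ)) ^ 2 ≤ 1 / ((N : ℝ) + 1) - 1 / (((N + 1 : ℕ) : ℝ) + 1) := by
        push_cast
        rw [div_sub_div _ _ (by positivity) (by positivity), div_le_div_iff₀ (by positivity)
          (by positivity)]
        nlinarith
      linarith
  rcases N with _ | _ | N
  · norm_num
  · norm_num
  · refine (h N).trans ?_
    have : 0 ≤ 1 / ((N : ℝ) + 1) := by positivity
    linarith

lemma wordSum_parseWeight_le (N : ℕ) (hN : 1 ≤ N) : wordSum N (parseWeight N) ≤ 512 * N := by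
  induction N using Nat.strong_induction_on with
  | _ N ih =>
    have h0 : parseWeight N = fun y => blockWeight N y + ∑ j ∈ Finset.Ico 1 N,
        (blockWeight j y * (1 / (2 ^ 10 * (j : ℝ) ^ 3))) *
          parseWeight (N - j) (fun i => y (j + i)) := funext fun y => parseWeight_eq N y
    rw [h0, wordSum_add, wordSum_finset_sum]
    have h1 : ∀ j ∈ Finset.Ico 1 N, wordSum N (fun y =>
        (blockWeight j y * (1 / (2 ^ 10 * (j : ℝ) ^ 3))) *
          parseWeight (N - j) (fun i => y (j + i))) ≤ (1 / (j : ℝ) ^ 2) * (128 * N) := by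
      intro j hj
      obtain ⟨hj1, hj2⟩ := Finset.mem_Ico.1 hj
      have hsplit := wordSum_mul (j := j) (m := N - j)
        (fun y => blockWeight j y * (1 / (2 ^ 10 * (j : ℝ) ^ 3))) (parseWeight (N - j))
        (fun y z h => by simp only [blockWeight_congr h])
      rw [Nat.add_sub_of_le hj2.le] at hsplit
      rw [hsplit]
      have hj0 : (0 : ℝ) < j := by exact_mod_cast hj1
      have a1 : wordSum j (fun y => blockWeight j y * (1 / (2 ^ 10 * (j : ℝ) ^ 3))) ≤
          (1 / 4) * (1 / (j : ℝ) ^ 2) := by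
        have := wordSum_blockWeight_le hj1
        simp_rw [mul_comm (blockWeight j _)]
        rw [wordSum_const_mul]
        calc _ ≤ 1 / (2 ^ 10 * (j : ℝ) ^ 3) * (256 * j) := by gcongr
          _ = _ := by field_simp; norm_num
      have a2 : wordSum (N - j) (parseWeight (N - j)) ≤ 512 * N := by
        refine (ih (N - j) (by omega) (by omega)).trans ?_
        have : ((N - j : ℕ) : ℝ) ≤ N := by exact_mod_cast Nat.sub_le N j
        linarith
      have a3 : 0 ≤ wordSum (N - j) (parseWeight (N - j)) :=
        Finset.sum_nonneg fun _ _ => parseWeight_nonneg _ _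
      calc _ ≤ (1 / 4) * (1 / (j : ℝ) ^ 2) * (512 * N) := by gcongr
        _ = _ := by ring
    have h2 := Finset.sum_le_sum h1
    rw [← Finset.sum_mul] at h2
    have h3 := wordSum_blockWeight_le hN
    have h4 : (∑ j ∈ Finset.Ico 1 N, 1 / (j : ℝ) ^ 2) * (128 * (N : ℝ)) ≤ 2 * (128 * (N : ℝ)) := by
      gcongr; exact sum_inv_sq_le N
    linarith

/-! ### The cost of a block -/

/-- `δ_j` normalised by `α = 1`. -/
def unitDelta (j : ℕ) : ℝ := (10 + 3 * Real.logb 2 j) / j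

lemma logb_two_natCast_nonneg (j : ℕ) : 0 ≤ Real.logb 2 j := by
  rcases Nat.eq_zero_or_pos j with rfl | h
  · simp
  · exact Real.logb_nonneg (by norm_num) (by exact_mod_cast h)

lemma unitDelta_nonneg (j : ℕ) : 0 ≤ unitDelta j := by
  have := logb_two_natCast_nonneg j
  unfold unitDelta
  positivity

lemma unitDelta_anti {j k : ℕ} (hj : 1 ≤ j) (hjk : j ≤ k) : unitDelta k ≤ unitDelta j := by
  have hj0 : (0 : ℝ) < j := by exact_mod_cast hj
  have hjk' : (j : ℝ) ≤ k := by exact_mod_cast hjk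
  have hk0 : (0 : ℝ) < k := hj0.trans_le hjk'
  unfold unitDelta
  rw [div_le_div_iff₀ hk0 hj0]
  have h0 := logb_two_natCast_nonneg j
  have h1 : Real.logb 2 k = Real.logb 2 j + Real.logb 2 (k / j) := by
    rw [Real.logb_div hk0.ne' hj0.ne']; ring
  have h2 : Real.logb 2 (k / j : ℝ) ≤ 2 * ((k : ℝ) / j - 1) := by
    unfold Real.logb
    have h3 := Real.log_le_sub_one_of_pos (show (0 : ℝ) < (k : ℝ) / j by positivity)
    have h4 := Real.log_two_gt_d9
    have h5 : 0 ≤ (k : ℝ) / j - 1 := by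
      rw [sub_nonneg, le_div_iff₀ hj0]; linarith
    rw [div_le_iff₀ (by linarith)]
    nlinarith
  have h6 : (j : ℝ) * Real.logb 2 (k / j : ℝ) ≤ 2 * (k - j) := by
    calc (j : ℝ) * Real.logb 2 (k / j : ℝ) ≤ j * (2 * ((k : ℝ) / j - 1)) := by gcongr
      _ = 2 * (k - j) := by field_simp
  rw [h1]
  nlinarith [mul_nonneg (sub_nonneg.2 hjk') h0]

lemma half_pow_add_unitDelta_le {s j : ℕ} (hs : 1 ≤ s) (hj : 4 * 2 ^ s ≤ j) :
    (1 / 2 : ℝ) ^ s + unitDelta j ≤ unitDelta (2 * 2 ^ s) := by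
  have h1 : 1 ≤ 4 * 2 ^ s := by have := Nat.one_le_two_pow (n := s); omega
  have h2 := unitDelta_anti h1 hj
  have hs' : (1 : ℝ) ≤ s := by exact_mod_cast hs
  have e1 : unitDelta (4 * 2 ^ s) = (16 + 3 * s) / 4 * (1 / 2 : ℝ) ^ s := by
    unfold unitDelta
    have : ((4 * 2 ^ s : ℕ) : ℝ) = (2 : ℝ) ^ (s + 2) := by push_cast; ring
    rw [this, Real.logb_pow, Real.logb_self_eq_one (by norm_num)]
    push_cast
    rw [pow_add, one_div, inv_pow]
    field_simp
    ring
  have e2 : unitDelta (2 * 2 ^ s) = (13 + 3 * s) / 2 * (1 / 2 : ℝ) ^ s := by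
    unfold unitDelta
    have : ((2 * 2 ^ s : ℕ) : ℝ) = (2 : ℝ) ^ (s + 1) := by push_cast; ring
    rw [this, Real.logb_pow, Real.logb_self_eq_one (by norm_num)]
    push_cast
    rw [pow_add, one_div, inv_pow]
    field_simp
    ring
  rw [e1] at h2
  rw [e2]
  have h3 : (0 : ℝ) < (1 / 2 : ℝ) ^ s := by positivity
  nlinarith

/-- The values `ψ i` of a potential along the orbit of `x` are bounded by the costs
`-2^{-n} - δ_r` of leaving the language of `X_n` within distance `r`. -/
def CostBound (x : ℤ → Bool) (ψ : ℤ → ℝ) : Prop :=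
  ∀ (i : ℤ) (t : ℝ), (∀ n : ℕ, 1 ≤ n → -(1 / 2 : ℝ) ^ n ≤ t ∨
    ∃ r : ℕ, 1 ≤ r ∧ ¬ InLang n (fun k => x (i - r + k)) (2 * r + 1) ∧
      -(1 / 2 : ℝ) ^ n - unitDelta r ≤ t) → ψ i ≤ t

lemma half_pow_le_half_pow {m n : ℕ} (h : m ≤ n) : (1 / 2 : ℝ) ^ n ≤ (1 / 2 : ℝ) ^ m :=
  pow_le_pow_of_le_one (by norm_num) (by norm_num) h

/-- Inside a long block from `X_s`, windows of radius `2 · 2^s` leave `X_n` for `n > s`. -/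
lemma not_inLang_window {x : ℤ → Bool} {a i : ℤ} {s n j : ℕ} (hs : 1 ≤ s) (hsn : s < n)
    (hj : 4 * 2 ^ s ≤ j) (h : InLang s (fun k => x (a + k)) j) (hi1 : a ≤ i) (hi2 : i < a + j) :
    ¬ InLang n (fun k => x (i - (2 * 2 ^ s : ℕ) + k)) (2 * (2 * 2 ^ s) + 1) := by
  intro hn
  set q := 2 * 2 ^ s with hq
  obtain ⟨d, hd⟩ : ∃ d : ℕ, i = a + d := ⟨(i - a).toNat, by omega⟩
  by_cases hc : d + q < j
  · have h1 : InLang s (fun k => x (i + k)) (q + 1) :=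
      h.subword (a := d) (by omega) (fun k _ => by
        simp only [hd]; congr 1; push_cast; ring)
    have h2 : InLang n (fun k => x (i + k)) (q + 1) :=
      hn.subword (a := q) (by omega) (fun k _ => by
        congr 1; push_cast; ring)
    exact not_inLang_of_lt hs hsn h1 h2
  · have h1 : InLang s (fun k => x (i - q + k)) (q + 1) :=
      h.subword (a := d - q) (by omega) (fun k _ => by
        simp only [hd]; congr 1; push_cast [show q ≤ d by omega]; ring)
    have h2 : InLang n (fun k => x (i - q + k)) (q + 1) :=
      hn.subword (a := 0) (by omega) (fun k _ => by simp)
    exact not_inLang_of_lt hs hsn h1 h2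

/-- The gain per letter in a block of length `j` from `X_s`. -/
def blockGain (s j : ℕ) : ℝ := if 4 * 2 ^ s ≤ j then (1 / 2 : ℝ) ^ s else 0

lemma CostBound.le_of_inLang {x : ℤ → Bool} {ψ : ℤ → ℝ} (hψ : CostBound x ψ) {a i : ℤ}
    {s j : ℕ} (hs : 1 ≤ s) (h : InLang s (fun k => x (a + k)) j) (hi1 : a ≤ i)
    (hi2 : i < a + j) : ψ i ≤ -blockGain s j := by
  refine hψ i _ fun n hn => ?_
  unfold blockGain
  split_ifs with hj
  · rcases le_or_gt n s with hns | hns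
    · left
      have := half_pow_le_half_pow hns
      linarith
    · right
      refine ⟨2 * 2 ^ s, by have := Nat.one_le_two_pow (n := s); omega,
        not_inLang_window hs hns hj h hi1 hi2, ?_⟩
      have := half_pow_add_unitDelta_le hs hj
      have := unitDelta_nonneg j
      have : 0 < (1 / 2 : ℝ) ^ n := by positivity
      linarith
  · left
    have : 0 < (1 / 2 : ℝ) ^ n := by positivity
    linarith

lemma CostBound.le_of_not_inLang {x : ℤ → Bool} {ψ : ℤ → ℝ} (hψ : CostBound x ψ) {a i : ℤ}
    {s j : ℕ} (hs : 1 ≤ s) (h : InLang s (fun k => x (a + k)) j)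
    (hnot : ∀ n, 1 ≤ n → ¬ InLang n (fun k => x (a + k)) (j + 1)) (hi1 : a ≤ i)
    (hi2 : i < a + j) : ψ i ≤ -(blockGain s j + unitDelta j) := by
  have hj1 : 1 ≤ j := by omega
  have hwin : ∀ n, 1 ≤ n → ¬ InLang n (fun k => x (i - j + k)) (2 * j + 1) := by
    intro n hn hw
    obtain ⟨d, hd⟩ : ∃ d : ℕ, i = a + d := ⟨(i - a).toNat, by omega⟩
    refine hnot n hn (hw.subword (a := j - d) (by omega) fun k _ => ?_)
    simp only [hd]; congr 1; push_cast [show d ≤ j by omega]; ring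
  refine hψ i _ fun n hn => Or.inr ?_
  unfold blockGain
  have h0 : 0 < (1 / 2 : ℝ) ^ n := by positivity
  split_ifs with hj
  · rcases le_or_gt n s with hns | hns
    · refine ⟨j, hj1, hwin n hn, ?_⟩
      have := half_pow_le_half_pow hns
      linarith
    · refine ⟨2 * 2 ^ s, by have := Nat.one_le_two_pow (n := s); omega,
        not_inLang_window hs hns hj h hi1 hi2, ?_⟩
      have := half_pow_add_unitDelta_le hs hj
      linarith
  · refine ⟨j, hj1, hwin n hn, ?_⟩
    linarith

lemma rpow_blockGain_le {s j : ℕ} (hs : 1 ≤ s) (hj : 1 ≤ j) {y : ℕ → Bool} (h : InLang s y j) :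
    (2 : ℝ) ^ (-((j : ℝ) * blockGain s j)) ≤ blockWeight j y := by
  classical
  obtain ⟨m, hm1, hm2, hm, hle⟩ : ∃ m, 1 ≤ m ∧ m ≤ Nat.log 2 j + 1 ∧ InLang m y j ∧
      (2 : ℝ) ^ (-((j : ℝ) * blockGain s j)) ≤ 16 * (2 : ℝ) ^ (-((j : ℝ) / 2 ^ m)) := by
    have hfour : ∀ m : ℕ, j ≤ 4 * 2 ^ m →
        1 ≤ 16 * (2 : ℝ) ^ (-((j : ℝ) / 2 ^ m)) := by
      intro m hjm
      have h1 : (j : ℝ) / 2 ^ m ≤ 4 := by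
        rw [div_le_iff₀ (by positivity)]; exact_mod_cast hjm
      have h2 : (2 : ℝ) ^ (-4 : ℝ) ≤ (2 : ℝ) ^ (-((j : ℝ) / 2 ^ m)) :=
        Real.rpow_le_rpow_of_exponent_le (by norm_num) (by linarith)
      have h3 : (2 : ℝ) ^ (-4 : ℝ) = 1 / 16 := by
        rw [Real.rpow_neg (by norm_num)]
        norm_num
      linarith
    have hlog := Nat.lt_pow_succ_log_self (b := 2) (by norm_num) j
    rcases le_or_gt s (Nat.log 2 j + 1) with hsl | hsl
    · refine ⟨s, hs, hsl, h, ?_⟩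
      unfold blockGain
      split_ifs with hc
      · have : (0 : ℝ) < (2 : ℝ) ^ (-((j : ℝ) / 2 ^ s)) := by positivity
        rw [one_div, inv_pow, ← div_eq_mul_inv]
        linarith
      · simpa using hfour s (by omega)
    · refine ⟨Nat.log 2 j + 1, by omega, le_rfl, h.of_le hlog hsl.le, ?_⟩
      have h2 : ¬ 4 * 2 ^ s ≤ j := by
        have := Nat.pow_le_pow_right (n := 2) (by norm_num) hsl.le
        simp only [Nat.succ_eq_add_one] at hlog
        omega
      simp only [blockGain, h2, if_false]
      simpa using hfour (Nat.log 2 j + 1) (by simp only [Nat.succ_eq_add_one] at hlog; omega)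
  refine hle.trans ?_
  unfold blockWeight
  refine le_trans ?_ (Finset.single_le_sum (f := fun n => if InLang n y j then
    16 * (2 : ℝ) ^ (-((j : ℝ) / 2 ^ n)) else 0) (fun n _ => ?_) (Finset.mem_Icc.2 ⟨hm1, hm2⟩))
  · simp [hm]
  · split_ifs <;> positivity

lemma two_rpow_unitDelta {j : ℕ} (hj : 1 ≤ j) :
    (2 : ℝ) ^ (-((j : ℝ) * unitDelta j)) = 1 / (2 ^ 10 * (j : ℝ) ^ 3) := by
  have hj0 : (0 : ℝ) < j := by exact_mod_cast hj
  have : (j : ℝ) * unitDelta j = 10 + Real.logb 2 j * 3 := by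
    unfold unitDelta; field_simp
  rw [this, Real.rpow_neg (by norm_num), Real.rpow_add (by norm_num), Real.rpow_mul (by norm_num),
    Real.rpow_logb (by norm_num) (by norm_num) hj0, one_div]
  norm_num

/-- The exponential of a Birkhoff sum is bounded by the total weight of the parsings. -/
lemma CostBound.rpow_sum_le {x : ℤ → Bool} {ψ : ℤ → ℝ} (hψ : CostBound x ψ) (N : ℕ)
    (hN : 1 ≤ N) (a : ℤ) (y : ℕ → Bool) (hy : ∀ k < N, y k = x (a + k)) :
    (2 : ℝ) ^ (∑ k ∈ Finset.range N, ψ (a + k)) ≤ parseWeight N y := by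
  classical
  induction N using Nat.strong_induction_on generalizing a y with
  | _ N ih =>
  have hpos : ∀ j ∈ Finset.Ico 1 N, 0 ≤ (blockWeight j y * (1 / (2 ^ 10 * (j : ℝ) ^ 3))) *
      parseWeight (N - j) (fun i => y (j + i)) := fun j _ =>
    mul_nonneg (mul_nonneg (blockWeight_nonneg _ _) (by positivity)) (parseWeight_nonneg _ _)
  rw [parseWeight_eq]
  by_cases hall : ∃ s, 1 ≤ s ∧ InLang s y N
  · obtain ⟨s, hs, hy'⟩ := hall
    refine le_trans ?_ (le_add_of_nonneg_right (Finset.sum_nonneg hpos))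
    refine le_trans ?_ (rpow_blockGain_le hs hN hy')
    refine Real.rpow_le_rpow_of_exponent_le (by norm_num) ?_
    have : ∑ k ∈ Finset.range N, ψ (a + k) ≤ ∑ k ∈ Finset.range N, -blockGain s N :=
      Finset.sum_le_sum fun k hk => hψ.le_of_inLang hs (hy'.congr hy) (by omega)
        (by have := Finset.mem_range.1 hk; omega)
    simpa using this
  · have hN2 : 2 ≤ N := by
      by_contra hlt
      have : N = 1 := by omega
      subst this
      exact hall ⟨1, le_rfl, inLang_one _ _⟩
    obtain ⟨j, hj1, hjN, ⟨s, hs, hj⟩, hnext⟩ : ∃ j, 1 ≤ j ∧ j < N ∧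
        (∃ s, 1 ≤ s ∧ InLang s y j) ∧ ¬ ∃ s, 1 ≤ s ∧ InLang s y (j + 1) := by
      by_contra! hcon
      refine hall ?_
      have : ∀ j, 1 ≤ j → j ≤ N → ∃ s, 1 ≤ s ∧ InLang s y j := by
        intro j hj
        induction j, hj using Nat.le_induction with
        | base => exact fun _ => ⟨1, le_rfl, inLang_one _ _⟩
        | succ j hj ihj => exact fun hle => hcon j hj (by omega) (ihj (by omega))
      exact this N hN le_rfl
    refine le_trans ?_ (le_add_of_nonneg_left (blockWeight_nonneg _ _))
    refine le_trans ?_ (Finset.single_le_sum hpos (Finset.mem_Ico.2 ⟨hj1, hjN⟩))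
    have hsplit : ∑ k ∈ Finset.range N, ψ (a + k) = ∑ k ∈ Finset.range j, ψ (a + k) +
        ∑ k ∈ Finset.range (N - j), ψ ((a + j) + k) := by
      conv_lhs => rw [← Nat.add_sub_of_le hjN.le, Finset.sum_range_add]
      congr 1
      refine Finset.sum_congr rfl fun k _ => ?_
      congr 1; push_cast; ring
    rw [hsplit, Real.rpow_add (by norm_num)]
    refine mul_le_mul ?_ ?_ (by positivity) (mul_nonneg (blockWeight_nonneg _ _) (by positivity))
    · have h1 : ∑ k ∈ Finset.range j, ψ (a + k) ≤
          ∑ k ∈ Finset.range j, -(blockGain s j + unitDelta j) := by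
        refine Finset.sum_le_sum fun k hk => ?_
        refine hψ.le_of_not_inLang hs (hj.congr fun i hi => hy i (by omega)) (fun n hn h => ?_)
          (by omega) (by have := Finset.mem_range.1 hk; omega)
        exact hnext ⟨n, hn, h.congr fun i hi => (hy i (by omega)).symm⟩
      rw [Finset.sum_const, Finset.card_range, nsmul_eq_mul] at h1
      calc (2 : ℝ) ^ (∑ k ∈ Finset.range j, ψ (a + k))
          ≤ (2 : ℝ) ^ (-((j : ℝ) * blockGain s j) + -((j : ℝ) * unitDelta j)) :=
            Real.rpow_le_rpow_of_exponent_le (by norm_num) (by linarith)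
        _ = (2 : ℝ) ^ (-((j : ℝ) * blockGain s j)) * (1 / (2 ^ 10 * (j : ℝ) ^ 3)) := by
            rw [Real.rpow_add (by norm_num), two_rpow_unitDelta hj1]
        _ ≤ _ := by
            gcongr
            exact rpow_blockGain_le hs hj1 hj
    · refine ih (N - j) (by omega) (by omega) (a + j) _ fun k hk => ?_
      rw [hy (j + k) (by omega)]
      congr 1; push_cast; ring

/-! ### Distances to the coded systems -/

lemma length_of_mem_genWords {n : ℕ} {w : List Bool} (hw : w ∈ genWords n) :
    w.length = 2 ^ n := by
  have := Nat.one_le_two_pow (n := n)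
  rcases hw with rfl | rfl <;> simp <;> omega

lemma get_of_mem_genWords {n : ℕ} {w : List Bool} (hw : w ∈ genWords n) :
    ∃ e : Bool, ∀ (i : ℕ) (h : i < w.length),
      w.get ⟨i, h⟩ = if i = 2 ^ n - 1 then !e else e := by
  have := Nat.one_le_two_pow (n := n)
  rcases hw with rfl | rfl
  · refine ⟨false, fun i h => ?_⟩
    simp only [List.length_append, List.length_replicate, List.length_singleton] at h
    simp only [List.get_eq_getElem, List.getElem_append, List.length_replicate]
    split_ifs with h1 h2 h2
    · omega
    · simp
    · simp
    · omega
  · refine ⟨true, fun i h => ?_⟩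
    simp only [List.length_append, List.length_replicate, List.length_singleton] at h
    simp only [List.get_eq_getElem, List.getElem_append, List.length_replicate]
    split_ifs with h1 h2 h2
    · omega
    · simp
    · simp
    · omega

lemma exists_between_of_strictMono {t : ℤ → ℤ} (ht : StrictMono t) (hbot : ∀ N, ∃ k, t k < N)
    (htop : ∀ N, ∃ k, N < t k) (i : ℤ) : ∃ k, t k ≤ i ∧ i < t (k + 1) := by
  obtain ⟨k0, hk0⟩ := hbot i
  obtain ⟨k1, hk1⟩ := htop i
  obtain ⟨k, hk, hmax⟩ := Int.exists_greatest_of_bdd (P := fun k => t k ≤ i)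
    ⟨k1, fun z hz => by
      by_contra! hlt
      have := ht hlt
      omega⟩ ⟨k0, hk0.le⟩
  refine ⟨k, hk, ?_⟩
  by_contra! hle
  have := hmax (k + 1) hle
  omega

lemma IsFreeConcat.inLang {n : ℕ} (hn : 1 ≤ n) {x : Bin} (hx : IsFreeConcat (genWords n) x)
    (a : ℤ) (j : ℕ) : InLang n (fun k => x (a + k)) j := by
  obtain ⟨t, ht, htop, hbot, hw⟩ := hx
  have hq : 2 ≤ 2 ^ n := by
    calc 2 = 2 ^ 1 := by norm_num
      _ ≤ 2 ^ n := Nat.pow_le_pow_right (by norm_num) hn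
  have hstep : ∀ k, t (k + 1) = t k + (2 : ℤ) ^ n := by
    intro k
    obtain ⟨w, hw, h1, -⟩ := hw k
    rw [h1, length_of_mem_genWords hw]
    push_cast; rfl
  have hdvd : ∀ k, (2 : ℤ) ^ n ∣ t k - t 0 := by
    intro k
    induction k using Int.induction_on with
    | zero => simp
    | succ k ih =>
      rw [hstep]
      exact (dvd_add ih (dvd_refl _)).trans (dvd_of_eq (by ring))
    | pred k ih =>
      have := hstep (-k - 1)
      rw [sub_add_cancel] at this
      exact (dvd_sub ih (dvd_refl _)).trans (dvd_of_eq (by rw [this]; ring))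
  refine ⟨t 0 - 2 - a, fun i _ => ?_⟩
  obtain ⟨k, hk1, hk2⟩ := exists_between_of_strictMono ht hbot htop (a + i)
  obtain ⟨l, hl⟩ : ∃ l : ℕ, a + i = t k + l := ⟨(a + i - t k).toNat, by omega⟩
  have hl2 : l < 2 ^ n := by
    have h := hstep k
    have h3 : (l : ℤ) < 2 ^ n := by omega
    exact_mod_cast h3
  have e1 : (2 : ℤ) ^ n ∣ (i : ℤ) - (t 0 - 2 - a) ↔ (2 : ℤ) ^ n ∣ (l : ℤ) + 2 :=
    dvd_iff_dvd_of_dvd_sub ((hdvd k).trans (dvd_of_eq (by linarith)))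
  have e2 : (2 : ℤ) ^ n ∣ (i : ℤ) - (t 0 - 2 - a) - 1 ↔ (2 : ℤ) ^ n ∣ (l : ℤ) + 1 :=
    dvd_iff_dvd_of_dvd_sub ((hdvd k).trans (dvd_of_eq (by linarith)))
  rw [e1, e2]
  obtain ⟨w, hwW, -, hwx⟩ := hw k
  obtain ⟨e, he⟩ := get_of_mem_genWords hwW
  have hlen := length_of_mem_genWords hwW
  have hx1 : ∀ l : ℕ, l < 2 ^ n → x (t k + l) = if l = 2 ^ n - 1 then !e else e :=
    fun l hl => by rw [hwx l (by omega), he]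
  have hcast : ((2 ^ n : ℕ) : ℤ) = 2 ^ n := by push_cast; rfl
  have hnext : a + ((i + 1 : ℕ) : ℤ) = t k + ((l + 1 : ℕ) : ℤ) := by push_cast; omega
  simp only [hl, hnext]
  constructor
  · intro hd
    obtain hl3 | hl3 : l + 1 = 2 ^ n ∨ l + 1 < 2 ^ n := by omega
    · exfalso
      have h3 : (2 : ℤ) ^ n ∣ 1 := by
        have h4 : (2 : ℤ) ^ n ∣ (l : ℤ) + 1 := by
          rw [← hcast, ← hl3]; push_cast; exact dvd_refl _
        exact (dvd_sub hd h4).trans (dvd_of_eq (by ring))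
      have := Int.le_of_dvd (by norm_num) h3
      omega
    · have h3 := Int.le_of_dvd (by omega) hd
      have h4 : l + 2 = 2 ^ n := by omega
      rw [hx1 l hl2, hx1 (l + 1) hl3, if_neg (by omega), if_pos (by omega)]
      simp
  · intro hd1 hd2
    have h3 : l + 1 ≠ 2 ^ n := fun h => hd2 (by rw [← hcast, ← h]; push_cast; exact dvd_refl _)
    have h4 : l + 2 ≠ 2 ^ n := fun h => hd1 (by rw [← hcast, ← h]; push_cast; exact dvd_refl _)
    rw [hx1 l hl2, hx1 (l + 1) (by omega), if_neg (by omega), if_neg (by omega)]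

/-- The point `x` agrees with some point of `S` on the coordinates of absolute value `< r`. -/
def AgreesOn (S : Set Bin) (r : ℕ) (x : Bin) : Prop :=
  ∃ y ∈ S, ∀ i : ℤ, i.natAbs < r → x i = y i

lemma isOpen_agreeing (r : ℕ) (y : Bin) : IsOpen {x : Bin | ∀ i : ℤ, i.natAbs < r → x i = y i} := by
  have : {x : Bin | ∀ i : ℤ, i.natAbs < r → x i = y i} =
      ⋂ i ∈ Finset.Ioo (-(r : ℤ)) r, {x : Bin | x i = y i} := by
    ext x
    simp only [Set.mem_ofPred_eq, Set.mem_iInter, Finset.mem_Ioo]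
    exact ⟨fun h i hi => h i (by omega), fun h i hi => h i (by omega)⟩
  rw [this]
  refine isOpen_biInter_finset fun i _ => ?_
  have hc : Continuous fun x : Bin => x i := continuous_apply i
  exact (isOpen_discrete ({y i} : Set Bool)).preimage hc

lemma isOpen_agreesOn (S : Set Bin) (r : ℕ) : IsOpen {x | AgreesOn S r x} := by
  have : {x | AgreesOn S r x} = ⋃ y ∈ S, {x : Bin | ∀ i : ℤ, i.natAbs < r → x i = y i} := by
    ext x; simp [AgreesOn]
  rw [this]
  exact isOpen_biUnion fun y _ => isOpen_agreeing r y

lemma AgreesOn.inLang {n r : ℕ} (hn : 1 ≤ n) {x : Bin} (h : AgreesOn (Xsub n) (r + 1) x) :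
    InLang n (fun k => x (-(r : ℤ) + k)) (2 * r + 1) := by
  obtain ⟨y, hy, hxy⟩ := h
  obtain ⟨z, hz, hzc⟩ := mem_closure_iff.1 hy _ (isOpen_agreeing (r + 1) y) (fun _ _ => rfl)
  refine (IsFreeConcat.inLang hn hzc (-(r : ℤ)) (2 * r + 1)).congr fun k hk => ?_
  rw [hz _ (by omega), hxy _ (by omega)]

lemma binDist_le_of_agree {x y : Bin} {r : ℕ} (h : ∀ i : ℤ, i.natAbs < r → x i = y i) :
    binDist x y ≤ (1 / 2 : ℝ) ^ r := by
  unfold binDist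
  split_ifs with hxy
  · positivity
  · refine pow_le_pow_of_le_one (by norm_num) (by norm_num) ?_
    obtain ⟨i, hi⟩ := Function.ne_iff.1 hxy
    refine le_csInf ⟨i.natAbs, i, rfl, hi⟩ ?_
    rintro m ⟨i, rfl, hi⟩
    by_contra! hlt
    exact hi (h i hlt)

lemma le_binDist_of_ne {x y : Bin} {r : ℕ} {i : ℤ} (hi : i.natAbs ≤ r) (h : x i ≠ y i) :
    (1 / 2 : ℝ) ^ r ≤ binDist x y := by
  unfold binDist
  rw [if_neg (fun e => h (by rw [e]))]
  refine pow_le_pow_of_le_one (by norm_num) (by norm_num) ?_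
  exact le_trans (Nat.sInf_le (m := i.natAbs) ⟨i, rfl, h⟩) hi

lemma binDist_nonneg (x y : Bin) : 0 ≤ binDist x y := by
  unfold binDist
  split_ifs <;> positivity

lemma distToSet_nonneg (x : Bin) (S : Set Bin) : 0 ≤ distToSet x S :=
  Real.sInf_nonneg (by rintro _ ⟨y, -, rfl⟩; exact binDist_nonneg x y)

lemma AgreesOn.distToSet_le {S : Set Bin} {r : ℕ} {x : Bin} (h : AgreesOn S r x) :
    distToSet x S ≤ (1 / 2 : ℝ) ^ r := by
  obtain ⟨y, hy, hxy⟩ := h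
  have hbdd : BddBelow ((fun y => binDist x y) '' S) :=
    ⟨0, by rintro _ ⟨y, -, rfl⟩; exact binDist_nonneg x y⟩
  exact (csInf_le hbdd (Set.mem_image_of_mem _ hy)).trans (binDist_le_of_agree hxy)

lemma le_distToSet_of_not_agreesOn {S : Set Bin} (hS : S.Nonempty) {r : ℕ} {x : Bin}
    (h : ¬ AgreesOn S (r + 1) x) : (1 / 2 : ℝ) ^ r ≤ distToSet x S := by
  refine le_csInf (hS.image _) ?_
  rintro _ ⟨y, hy, rfl⟩
  unfold AgreesOn at h
  push Not at h
  obtain ⟨i, hi, hne⟩ := h y hy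
  exact le_binDist_of_ne (by omega) hne

lemma AgreesOn.anti {S : Set Bin} {r s : ℕ} (hrs : r ≤ s) {x : Bin} (h : AgreesOn S s x) :
    AgreesOn S r x := by
  obtain ⟨y, hy, hxy⟩ := h
  exact ⟨y, hy, fun i hi => hxy i (by omega)⟩

lemma distToSet_eq_zero {S : Set Bin} {x : Bin} (h : ∀ r, AgreesOn S r x) :
    distToSet x S = 0 := by
  refine le_antisymm ?_ (distToSet_nonneg x S)
  refine ge_of_tendsto' (tendsto_pow_atTop_nhds_zero_of_lt_one (r := (1 / 2 : ℝ)) (by norm_num)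
    (by norm_num)) fun r => (h r).distToSet_le

/-- The distance to `S` is `2^{-r}` where `r` is the exact radius of agreement with `S`. -/
lemma distToSet_eq {S : Set Bin} {r : ℕ} {x : Bin} (h : AgreesOn S r x)
    (h' : ¬ AgreesOn S (r + 1) x) : distToSet x S = (1 / 2 : ℝ) ^ r :=
  le_antisymm h.distToSet_le (le_distToSet_of_not_agreesOn (h.imp fun _ hy => hy.1) h')

lemma exists_radius {S : Set Bin} {x : Bin} {r s : ℕ} (hr : AgreesOn S r x)
    (hs : ¬ AgreesOn S s x) : ∃ p, r ≤ p ∧ p < s ∧ AgreesOn S p x ∧ ¬ AgreesOn S (p + 1) x := by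
  classical
  have hex : ∃ m, ¬ AgreesOn S m x := ⟨s, hs⟩
  have h1 := Nat.find_spec hex
  have h2 : r < Nat.find hex := by
    by_contra! hle
    exact h1 (hr.anti hle)
  have h3 : Nat.find hex ≤ s := Nat.find_min' hex hs
  refine ⟨Nat.find hex - 1, by omega, by omega, ?_, ?_⟩
  · have := Nat.find_min hex (m := Nat.find hex - 1) (by omega)
    exact not_not.1 this
  · rwa [Nat.sub_add_cancel (by omega)]

lemma deltaOf_half_pow (α : ℝ) (r : ℕ) : deltaOf α ((1 / 2 : ℝ) ^ r) = unitDelta r / α := by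
  have h : -Real.logb 2 ((1 / 2 : ℝ) ^ r) = r := by
    rw [Real.logb_pow, one_div, Real.logb_inv, Real.logb_self_eq_one (by norm_num)]
    ring
  unfold deltaOf unitDelta
  rw [if_neg (by positivity), h, div_div, mul_comm α]

/-- The periodic point built from the word `e^{2^n-1} ē`, with cut points `≡ -s`. -/
lemma periodic_mem_Xsub (n : ℕ) (s : ℤ) (e : Bool) :
    (fun i : ℤ => if (i + s) % 2 ^ n = 2 ^ n - 1 then !e else e) ∈ Xsub n := by
  refine subset_closure ⟨fun k => k * 2 ^ n - s, ?_, ?_, ?_, ?_⟩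
  · intro a b hab
    have : a * 2 ^ n < b * (2 : ℤ) ^ n := mul_lt_mul_of_pos_right hab (by positivity)
    simpa using this
  · intro N
    refine ⟨|N| + |s| + 1, ?_⟩
    have h1 : (|N| + |s| + 1) * 1 ≤ (|N| + |s| + 1) * (2 : ℤ) ^ n :=
      mul_le_mul_of_nonneg_left (one_le_pow₀ (by norm_num)) (by positivity)
    have := le_abs_self N
    have := le_abs_self s
    simp only
    omega
  · intro N
    refine ⟨-(|N| + |s| + 1), ?_⟩
    have h1 : (|N| + |s| + 1) * 1 ≤ (|N| + |s| + 1) * (2 : ℤ) ^ n :=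
      mul_le_mul_of_nonneg_left (one_le_pow₀ (by norm_num)) (by positivity)
    have := neg_abs_le N
    have := neg_abs_le s
    simp only [neg_mul]
    omega
  · intro k
    have hone := Nat.one_le_two_pow (n := n)
    refine ⟨List.replicate (2 ^ n - 1) e ++ [!e], ?_, ?_, ?_⟩
    · cases e <;> simp [genWords]
    · simp only [List.length_append, List.length_replicate, List.length_singleton,
        Nat.sub_add_cancel hone]
      push_cast; ring
    · intro i hi
      simp only [List.length_append, List.length_replicate, List.length_singleton,
        Nat.sub_add_cancel hone] at hi
      have hi' : (i : ℤ) < 2 ^ n := by exact_mod_cast hi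
      have hm : (k * 2 ^ n - s + (i : ℤ) + s) % 2 ^ n = i := by
        have : k * 2 ^ n - s + (i : ℤ) + s = i + 2 ^ n * k := by ring
        rw [this, Int.add_mul_emod_self_left]
        exact Int.emod_eq_of_lt (by positivity) hi'
      have hcast : ((2 ^ n : ℕ) : ℤ) = 2 ^ n := by push_cast; rfl
      simp only [hm, List.get_eq_getElem, List.getElem_append, List.length_replicate]
      split_ifs with h1 h2 h2
      · omega
      · simp
      · simp
      · omega

lemma agreesOn_one {n : ℕ} (hn : 1 ≤ n) (x : Bin) : AgreesOn (Xsub n) 1 x := by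
  refine ⟨_, periodic_mem_Xsub n 0 (x 0), fun i hi => ?_⟩
  obtain rfl : i = 0 := by omega
  have : (2 : ℤ) ≤ 2 ^ n := by
    calc (2 : ℤ) = 2 ^ 1 := by norm_num
      _ ≤ 2 ^ n := pow_le_pow_right₀ (by norm_num) hn
  rw [if_neg (by simp; omega)]

lemma agreesOn_const {n : ℕ} (e : Bool) : AgreesOn (Xsub (n + 1)) (2 ^ n - 1) (fun _ => e) := by
  refine ⟨_, periodic_mem_Xsub (n + 1) (2 ^ n) e, fun i hi => ?_⟩
  have hp : (2 : ℤ) ^ (n + 1) = 2 ^ n + 2 ^ n := by ring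
  have hcast : ((2 ^ n : ℕ) : ℤ) = 2 ^ n := by push_cast; rfl
  rw [if_neg]
  rw [Int.emod_eq_of_lt (by omega) (by omega)]
  omega

/-- Either `x ∈ X_n` up to closure, or the drop at `x` is `δ_r` with `r` the radius of agreement. -/
lemma deltaOf_distToSet_cases (α : ℝ) {n : ℕ} (hn : 1 ≤ n) (x : Bin) :
    ((∀ r, AgreesOn (Xsub n) r x) ∧ deltaOf α (distToSet x (Xsub n)) = 0) ∨
    ∃ r, 1 ≤ r ∧ AgreesOn (Xsub n) r x ∧ ¬ AgreesOn (Xsub n) (r + 1) x ∧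
      deltaOf α (distToSet x (Xsub n)) = unitDelta r / α := by
  by_cases h : ∀ r, AgreesOn (Xsub n) r x
  · left
    exact ⟨h, by rw [distToSet_eq_zero h]; simp [deltaOf]⟩
  · right
    push Not at h
    obtain ⟨s, hs⟩ := h
    obtain ⟨r, hr1, -, hr2, hr3⟩ := exists_radius (agreesOn_one hn x) hs
    exact ⟨r, hr1, hr2, hr3, by rw [distToSet_eq hr2 hr3, deltaOf_half_pow]⟩

lemma deltaOf_distToSet_nonneg {α : ℝ} (hα : 0 < α) {n : ℕ} (hn : 1 ≤ n) (x : Bin) :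
    0 ≤ deltaOf α (distToSet x (Xsub n)) := by
  rcases deltaOf_distToSet_cases α hn x with ⟨-, h⟩ | ⟨r, -, -, -, h⟩
  · exact h.ge
  · rw [h]; exact div_nonneg (unitDelta_nonneg r) hα.le

lemma deltaOf_distToSet_le_of_agreesOn {α : ℝ} (hα : 0 < α) {n : ℕ} (hn : 1 ≤ n) {x : Bin}
    {r : ℕ} (hr : 1 ≤ r) (h : AgreesOn (Xsub n) r x) :
    deltaOf α (distToSet x (Xsub n)) ≤ unitDelta r / α := by
  rcases deltaOf_distToSet_cases α hn x with ⟨-, h⟩ | ⟨p, -, -, hp, h'⟩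
  · rw [h]; exact div_nonneg (unitDelta_nonneg r) hα.le
  · rw [h']
    have : r ≤ p := by
      by_contra! hlt
      exact hp (h.anti hlt)
    exact div_le_div_of_nonneg_right (unitDelta_anti hr this) hα.le

lemma le_deltaOf_distToSet_of_not_agreesOn {α : ℝ} (hα : 0 < α) {n : ℕ} (hn : 1 ≤ n) {x : Bin}
    {r : ℕ} (h : ¬ AgreesOn (Xsub n) (r + 1) x) :
    unitDelta r / α ≤ deltaOf α (distToSet x (Xsub n)) := by
  rcases deltaOf_distToSet_cases α hn x with ⟨h', -⟩ | ⟨p, hp1, hp, -, h'⟩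
  · exact absurd (h' _) h
  · rw [h']
    have : p ≤ r := by
      by_contra! hlt
      exact h (hp.anti hlt)
    exact div_le_div_of_nonneg_right (unitDelta_anti hp1 this) hα.le

lemma measurable_distToSet {n : ℕ} (hn : 1 ≤ n) :
    Measurable fun x : Bin => distToSet x (Xsub n) := by
  classical
  have h : (fun x : Bin => distToSet x (Xsub n)) = fun x => ⨅ r : ℕ,
      if AgreesOn (Xsub n) r x then (1 / 2 : ℝ) ^ r else 1 := by
    funext x
    have hbdd : BddBelow (Set.range fun r : ℕ =>
        if AgreesOn (Xsub n) r x then (1 / 2 : ℝ) ^ r else 1) :=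
      ⟨0, by rintro _ ⟨r, rfl⟩; dsimp only; split_ifs <;> positivity⟩
    refine le_antisymm (le_ciInf fun r => ?_) ?_
    · split_ifs with hr
      · exact hr.distToSet_le
      · simpa using ((agreesOn_one hn x).anti zero_le_one).distToSet_le
    · rcases deltaOf_distToSet_cases 1 hn x with ⟨h, -⟩ | ⟨p, -, hp1, hp2, -⟩
      · rw [distToSet_eq_zero h]
        refine ge_of_tendsto' (tendsto_pow_atTop_nhds_zero_of_lt_one (r := (1 / 2 : ℝ))
          (by norm_num) (by norm_num)) fun r => (ciInf_le hbdd r).trans ?_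
        simp [h r]
      · rw [distToSet_eq hp1 hp2]
        refine (ciInf_le hbdd p).trans ?_
        simp [hp1]
  rw [h]
  refine Measurable.iInf fun r => Measurable.ite ?_ measurable_const measurable_const
  exact (isOpen_agreesOn _ _).measurableSet

lemma measurable_deltaOf (α : ℝ) : Measurable (deltaOf α) := by
  unfold deltaOf
  refine Measurable.ite (measurableSet_singleton 0) measurable_const ?_
  unfold Real.logb
  fun_prop

lemma measurable_phi (α : ℝ) (c : ℕ → ℝ) : Measurable (phi α c) := by
  unfold phi phiN
  refine Measurable.iSup fun n => ?_
  exact ((measurable_deltaOf α).comp (measurable_distToSet (by omega))).const_sub _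

/-! ### The constants and the potential -/

lemma hasSum_half_pow (n : ℕ) (c : ℝ) :
    HasSum (fun k : ℕ => 1 / (2 ^ (n + k + 1) * c)) ((1 / 2 : ℝ) ^ n / c) := by
  have h := (hasSum_geometric_two).mul_left ((1 / 2 : ℝ) ^ n / 2 / c)
  have e : (1 / 2 : ℝ) ^ n / 2 / c * 2 = (1 / 2 : ℝ) ^ n / c := by ring
  rw [e] at h
  refine h.congr_fun fun k => ?_
  rw [pow_add, pow_add, one_div, one_div, inv_pow, inv_pow, mul_inv, mul_inv, mul_inv]
  ring

lemma summable_cseq {α : ℝ} (hα : 0 < α) {β : ℕ → ℝ} (hge : ∀ n : ℕ, 1 ≤ n → α ≤ β n) {n : ℕ}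
    (hn : 1 ≤ n) : Summable fun k : ℕ => 1 / (2 ^ (n + k + 1) * β (n + k)) := by
  refine Summable.of_nonneg_of_le (fun k => ?_) (fun k => ?_) (hasSum_half_pow n α).summable
  · have := hge (n + k) (by omega)
    have : 0 < β (n + k) := by linarith
    positivity
  · have := hge (n + k) (by omega)
    gcongr

lemma mul_cseq_le {α : ℝ} (hα : 0 < α) {β : ℕ → ℝ} (hge : ∀ n : ℕ, 1 ≤ n → α ≤ β n) {b : ℝ}
    (hb : ∀ n : ℕ, 1 ≤ n → β n ≤ b) {n : ℕ} (hn : 1 ≤ n) :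
    b * cseq β n ≤ -(1 / 2 : ℝ) ^ n := by
  have hb0 : 0 < b := by have := hge 1 le_rfl; have := hb 1 le_rfl; linarith
  have h : (1 / 2 : ℝ) ^ n / b ≤ ∑' k : ℕ, 1 / (2 ^ (n + k + 1) * β (n + k)) := by
    rw [← (hasSum_half_pow n b).tsum_eq]
    refine (hasSum_half_pow n b).summable.tsum_le_tsum (fun k => ?_) (summable_cseq hα hge hn)
    have h1 := hge (n + k) (by omega)
    have h2 := hb (n + k) (by omega)
    have : 0 < β (n + k) := by linarith
    gcongr
  rw [div_le_iff₀ hb0] at h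
  unfold cseq
  linarith

lemma le_cseq {α : ℝ} (hα : 0 < α) {β : ℕ → ℝ} (hge : ∀ n : ℕ, 1 ≤ n → α ≤ β n) {n : ℕ}
    (hn : 1 ≤ n) : -((1 / 2 : ℝ) ^ n / α) ≤ cseq β n := by
  unfold cseq
  rw [neg_le_neg_iff, ← (hasSum_half_pow n α).tsum_eq]
  refine (summable_cseq hα hge hn).tsum_le_tsum (fun k => ?_) (hasSum_half_pow n α).summable
  have := hge (n + k) (by omega)
  gcongr

lemma cseq_nonpos {α : ℝ} (hα : 0 < α) {β : ℕ → ℝ} (hge : ∀ n : ℕ, 1 ≤ n → α ≤ β n) {n : ℕ}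
    (hn : 1 ≤ n) : cseq β n ≤ 0 := by
  unfold cseq
  rw [neg_nonpos]
  refine tsum_nonneg fun k => ?_
  have := hge (n + k) (by omega)
  have : 0 < β (n + k) := by linarith
  positivity

lemma phiN_nonpos {α : ℝ} (hα : 0 < α) {β : ℕ → ℝ} (hge : ∀ n : ℕ, 1 ≤ n → α ≤ β n) {n : ℕ}
    (hn : 1 ≤ n) (x : Bin) : phiN α (cseq β) n x ≤ 0 := by
  have := cseq_nonpos hα hge hn
  have := deltaOf_distToSet_nonneg hα hn x
  unfold phiN
  linarith

lemma phi_nonpos {α : ℝ} (hα : 0 < α) {β : ℕ → ℝ} (hge : ∀ n : ℕ, 1 ≤ n → α ≤ β n) (x : Bin) :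
    phi α (cseq β) x ≤ 0 := ciSup_le fun n => phiN_nonpos hα hge (by omega) x

lemma phiN_le_phi {α : ℝ} (hα : 0 < α) {β : ℕ → ℝ} (hge : ∀ n : ℕ, 1 ≤ n → α ≤ β n) (n : ℕ)
    (x : Bin) : phiN α (cseq β) (n + 1) x ≤ phi α (cseq β) x :=
  le_ciSup (f := fun n => phiN α (cseq β) (n + 1) x)
    ⟨0, by rintro _ ⟨n, rfl⟩; exact phiN_nonpos hα hge (by omega) x⟩ n

lemma le_phi {α : ℝ} (hα : 0 < α) {β : ℕ → ℝ} (hge : ∀ n : ℕ, 1 ≤ n → α ≤ β n) (x : Bin) :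
    cseq β 1 - unitDelta 1 / α ≤ phi α (cseq β) x := by
  refine le_trans ?_ (phiN_le_phi hα hge 0 x)
  have := deltaOf_distToSet_le_of_agreesOn hα (n := 1) le_rfl le_rfl (agreesOn_one le_rfl x)
  unfold phiN
  simp only [zero_add]
  linarith

lemma integrable_phi {α : ℝ} (hα : 0 < α) {β : ℕ → ℝ} (hge : ∀ n : ℕ, 1 ≤ n → α ≤ β n)
    (μ : Measure Bin) [IsFiniteMeasure μ] : Integrable (phi α (cseq β)) μ := by
  refine Integrable.of_mem_Icc (cseq β 1 - unitDelta 1 / α) 0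
    (measurable_phi α _).aemeasurable (ae_of_all _ fun x => ⟨le_phi hα hge x, phi_nonpos hα hge x⟩)

lemma phi_costBound {α : ℝ} (hα : 0 < α) {β : ℕ → ℝ} (hge : ∀ n : ℕ, 1 ≤ n → α ≤ β n) {b : ℝ}
    (hb : ∀ n : ℕ, 1 ≤ n → β n ≤ b) (x : Bin) :
    CostBound x fun i => b * phi α (cseq β) (fun k => x (k + i)) := by
  intro i t ht
  have hαb : α ≤ b := (hge 1 le_rfl).trans (hb 1 le_rfl)
  have hb0 : 0 < b := hα.trans_le hαb
  change b * phi α (cseq β) (fun k => x (k + i)) ≤ t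
  rw [mul_comm, ← le_div_iff₀ hb0]
  refine ciSup_le fun n => ?_
  rw [le_div_iff₀ hb0]
  have hc := mul_cseq_le hα hge hb (n := n + 1) (by omega)
  unfold phiN
  rcases ht (n + 1) (by omega) with h | ⟨r, -, hr, h⟩
  · have := mul_nonneg hb0.le
      (deltaOf_distToSet_nonneg hα (n := n + 1) (by omega) (fun k => x (k + i)))
    linarith
  · have hna : ¬ AgreesOn (Xsub (n + 1)) (r + 1) (fun k => x (k + i)) := fun hag =>
      hr ((hag.inLang (by omega)).congr fun k _ => by congr 1; ring)
    have h1 := le_deltaOf_distToSet_of_not_agreesOn hα (by omega) hna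
    have h2 : unitDelta r ≤ b * (unitDelta r / α) := by
      rw [mul_div_assoc', le_div_iff₀ hα, mul_comm]
      exact mul_le_mul_of_nonneg_right hαb (unitDelta_nonneg r)
    have h3 := mul_le_mul_of_nonneg_left h1 hb0.le
    linarith

lemma unitDelta_two_pow (n : ℕ) : unitDelta (2 ^ n) = 10 * (1 / 2 : ℝ) ^ n + 3 * (n ^ 1 / 2 ^ n) := by
  unfold unitDelta
  push_cast
  rw [Real.logb_pow, Real.logb_self_eq_one (by norm_num), one_div, inv_pow]
  field_simp

/-- The potential vanishes at the two fixed points. -/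
lemma phi_const {α : ℝ} (hα : 0 < α) {β : ℕ → ℝ} (hge : ∀ n : ℕ, 1 ≤ n → α ≤ β n) (e : Bool) :
    phi α (cseq β) (fun _ => e) = 0 := by
  refine le_antisymm (phi_nonpos hα hge _) ?_
  have hgeo := tendsto_pow_atTop_nhds_zero_of_lt_one (r := (1 / 2 : ℝ)) (by norm_num) (by norm_num)
  have hlin := tendsto_pow_const_div_const_pow_of_one_lt 1 (r := (2 : ℝ)) (by norm_num)
  have hlim : Tendsto (fun n : ℕ => -((1 / 2 : ℝ) ^ (n + 2) / α) -
      (10 * (1 / 2 : ℝ) ^ n + 3 * (n ^ 1 / 2 ^ n)) / α) atTop (𝓝 0) := by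
    have h1 := ((((tendsto_add_atTop_iff_nat 2).2 hgeo).div_const α).neg).sub
      (((hgeo.const_mul 10).add (hlin.const_mul 3)).div_const α)
    simpa using h1
  refine le_of_tendsto' hlim fun n => ?_
  refine le_trans ?_ (phiN_le_phi hα hge (n + 1) _)
  have hone := Nat.one_le_two_pow (n := n)
  have hag : AgreesOn (Xsub (n + 2)) (2 ^ n) (fun _ => e) :=
    (agreesOn_const (n := n + 1) e).anti (by rw [pow_succ]; omega)
  have h1 := deltaOf_distToSet_le_of_agreesOn hα (by omega) hone hag
  rw [unitDelta_two_pow] at h1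
  have h2 := le_cseq hα hge (n := n + 2) (by omega)
  unfold phiN
  linarith

/-- A point at which the potential vanishes has essentially at most one change of letter. -/
lemma le_one_of_phi_eq_zero {α : ℝ} (hα : 0 < α) {β : ℕ → ℝ} (hge : ∀ n : ℕ, 1 ≤ n → α ≤ β n)
    {b : ℝ} (hb : ∀ n : ℕ, 1 ≤ n → β n ≤ b) {x : Bin} (hx : phi α (cseq β) x = 0)
    (h0 : x 0 ≠ x 1) {i : ℕ} (hi : x i ≠ x (i + 1)) : i ≤ 1 := by
  have hb0 : 0 < b := by have := hge 1 le_rfl; have := hb 1 le_rfl; linarith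
  set R := i + 2 with hR
  have hpos : 0 < unitDelta R := by
    have := logb_two_natCast_nonneg R
    have : (0 : ℝ) < R := by exact_mod_cast (by omega : 0 < R)
    unfold unitDelta
    positivity
  obtain ⟨n, hn⟩ : ∃ n, -min ((1 / 2 : ℝ) ^ (2 * R + 2) / b) (unitDelta R / α) <
      phiN α (cseq β) (n + 1) x := by
    refine exists_lt_of_lt_ciSup (lt_of_lt_of_eq ?_ hx.symm)
    rw [neg_lt_zero]
    exact lt_min (by positivity) (by positivity)
  have hm1 := min_le_left ((1 / 2 : ℝ) ^ (2 * R + 2) / b) (unitDelta R / α)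
  have hm2 := min_le_right ((1 / 2 : ℝ) ^ (2 * R + 2) / b) (unitDelta R / α)
  have hc := mul_cseq_le hα hge hb (n := n + 1) (by omega)
  have hd := deltaOf_distToSet_nonneg hα (n := n + 1) (by omega) x
  unfold phiN at hn
  have hnR : 2 * R + 2 ≤ n + 1 := by
    by_contra! hlt
    have h1 := half_pow_le_half_pow hlt.le
    have h2 : cseq β (n + 1) ≤ -((1 / 2 : ℝ) ^ (2 * R + 2) / b) := by
      rw [← neg_div, le_div_iff₀ hb0]
      linarith
    linarith
  have hag : AgreesOn (Xsub (n + 1)) (R + 1) x := by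
    by_contra hna
    have h1 := le_deltaOf_distToSet_of_not_agreesOn hα (by omega) hna
    have h2 := cseq_nonpos hα hge (n := n + 1) (by omega)
    linarith
  have hL := hag.inLang (by omega)
  have hdv := hL.dvd_of_ne_of_ne (a := R) (b := R + i) (by omega) (by omega)
    (by simpa using h0) (by
      have e1 : -(R : ℤ) + ((R + i : ℕ) : ℤ) = i := by push_cast; ring
      have e2 : -(R : ℤ) + ((R + i + 1 : ℕ) : ℤ) = i + 1 := by push_cast; ring
      rwa [e1, e2])
  have hq : 2 * R + 2 < 2 ^ (n + 1) := hnR.trans_lt Nat.lt_two_pow_self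
  have hq' : (2 * R + 2 : ℤ) < 2 ^ (n + 1) := by exact_mod_cast hq
  push_cast at hdv
  rcases hdv with h | h | h <;>
    have := Int.eq_zero_of_abs_lt_dvd h (by rw [abs_lt]; constructor <;> omega) <;> omega

/-! ### Entropy of observables -/

lemma neg_mul_logb_nonneg {p : ℝ} (h0 : 0 ≤ p) (h1 : p ≤ 1) : 0 ≤ -(p * Real.logb 2 p) := by
  have : Real.logb 2 p ≤ 0 := Real.logb_nonpos (by norm_num) h0 h1
  nlinarith

lemma entOfObs_nonneg {X F : Type*} [MeasurableSpace X] [Fintype F] (μ : Measure X)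
    [IsProbabilityMeasure μ] (f : X → F) : 0 ≤ entOfObs μ f :=
  Finset.sum_nonneg fun _ _ => neg_mul_logb_nonneg ENNReal.toReal_nonneg
    (ENNReal.toReal_le_of_le_ofReal zero_le_one (by simpa using prob_le_one))

lemma measureReal_preimage_eq_sum {X B : Type*} [MeasurableSpace X] [Fintype B]
    (μ : Measure X) [IsFiniteMeasure μ] {s : Set X} {W : X → B}
    (hW : ∀ b, MeasurableSet (W ⁻¹' {b})) (hs : MeasurableSet s) :
    μ.real s = ∑ b, μ.real (s ∩ W ⁻¹' {b}) := by
  rw [← measureReal_iUnion_fintype (μ := μ)]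
  · congr 1
    ext x
    simp
  · intro b c hbc
    refine Set.disjoint_left.2 fun x hx hx' => hbc ?_
    exact hx.2.symm.trans hx'.2
  · exact fun b => hs.inter (hW b)

lemma entOfObs_le_prod {X A B : Type*} [MeasurableSpace X] [Fintype A] [Fintype B]
    (μ : Measure X) [IsProbabilityMeasure μ] {F : X → A} {W : X → B}
    (hF : ∀ a, MeasurableSet (F ⁻¹' {a})) (hW : ∀ b, MeasurableSet (W ⁻¹' {b})) :
    entOfObs μ F ≤ entOfObs μ fun x => (F x, W x) := by
  unfold entOfObs
  rw [Fintype.sum_prod_type]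
  refine Finset.sum_le_sum fun a _ => ?_
  have hp := measureReal_preimage_eq_sum μ hW (hF a)
  have hcell : ∀ b, (fun x => (F x, W x)) ⁻¹' {(a, b)} = F ⁻¹' {a} ∩ W ⁻¹' {b} := by
    intro b
    ext x
    simp
  simp only [hcell, ← Measure.real_def]
  calc -(μ.real (F ⁻¹' {a}) * Real.logb 2 (μ.real (F ⁻¹' {a})))
      = ∑ b, -(μ.real (F ⁻¹' {a} ∩ W ⁻¹' {b}) * Real.logb 2 (μ.real (F ⁻¹' {a}))) := by
        rw [Finset.sum_neg_distrib, ← Finset.sum_mul, ← hp]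
    _ ≤ _ := by
        refine Finset.sum_le_sum fun b _ => ?_
        rcases (measureReal_nonneg (μ := μ) (s := F ⁻¹' {a} ∩ W ⁻¹' {b})).eq_or_lt with h | h
        · simp [← h]
        · have hle : μ.real (F ⁻¹' {a} ∩ W ⁻¹' {b}) ≤ μ.real (F ⁻¹' {a}) :=
            measureReal_mono Set.inter_subset_left
          have := Real.logb_le_logb_of_le (b := 2) (by norm_num) h hle
          nlinarith

lemma gibbs_cell {p q Z I : ℝ} (hp : 0 < p) (hq : 0 < q) (hZ : 0 < Z)
    (hI : I ≤ p * Real.logb 2 q) :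
    -(p * Real.logb 2 p) + I ≤ p * Real.logb 2 Z + (q / Z - p) / Real.log 2 := by
  have hl : 0 < Real.log 2 := Real.log_pos (by norm_num)
  have h := Real.log_le_sub_one_of_pos (x := q / Z / p) (by positivity)
  rw [Real.log_div (by positivity) hp.ne', Real.log_div hq.ne' hZ.ne'] at h
  have h2 : p * (Real.log q - Real.log Z - Real.log p) ≤ q / Z - p := by
    calc _ ≤ p * (q / Z / p - 1) := mul_le_mul_of_nonneg_left h hp.le
      _ = _ := by field_simp
  have h3 := (div_le_div_iff_of_pos_right hl).2 h2
  have h4 : p * (Real.log q - Real.log Z - Real.log p) / Real.log 2 =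
      p * Real.logb 2 q - p * Real.logb 2 Z - p * Real.logb 2 p := by
    simp only [Real.logb]
    ring
  linarith

lemma gibbs_inequality {X C : Type*} [MeasurableSpace X] [Fintype C] (μ : Measure X)
    [IsProbabilityMeasure μ] {G : X → C} (hG : ∀ c, MeasurableSet (G ⁻¹' {c})) {Q : C → ℝ}
    (hQ : ∀ c, 0 ≤ Q c) {Z : ℝ} (hZ : 0 < Z) (hQZ : ∑ c, Q c ≤ Z) {l : X → ℝ}
    (hl : Integrable l μ) (hlQ : ∀ x, (2 : ℝ) ^ l x ≤ Q (G x)) :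
    entOfObs μ G + ∫ x, l x ∂μ ≤ Real.logb 2 Z := by
  have hl2 : 0 < Real.log 2 := Real.log_pos (by norm_num)
  have huniv : (⋃ c, G ⁻¹' {c}) = Set.univ := by
    ext x
    simp
  have hdisj : Pairwise (Function.onFun Disjoint fun c => G ⁻¹' {c}) := by
    intro b c hbc
    exact Set.disjoint_left.2 fun x hx hx' => hbc (hx.symm.trans hx')
  have hint : ∫ x, l x ∂μ = ∑ c, ∫ x in G ⁻¹' {c}, l x ∂μ := by
    rw [← integral_iUnion_fintype hG hdisj (fun c => hl.integrableOn), huniv,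
      setIntegral_univ]
  have hone : ∑ c, μ.real (G ⁻¹' {c}) = 1 := by
    rw [← measureReal_iUnion_fintype hdisj hG, huniv, probReal_univ]
  have hcell : ∀ c, -(μ.real (G ⁻¹' {c}) * Real.logb 2 (μ.real (G ⁻¹' {c}))) +
      ∫ x in G ⁻¹' {c}, l x ∂μ ≤
      μ.real (G ⁻¹' {c}) * Real.logb 2 Z + (Q c / Z - μ.real (G ⁻¹' {c})) / Real.log 2 := by
    intro c
    rcases (measureReal_nonneg (μ := μ) (s := G ⁻¹' {c})).eq_or_lt with h | h
    · have h0 : μ (G ⁻¹' {c}) = 0 := (measureReal_eq_zero_iff).1 h.symm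
      rw [← h, setIntegral_measure_zero _ h0]
      have := hQ c
      simp only [zero_mul, neg_zero, add_zero, sub_zero, zero_add]
      positivity
    · obtain ⟨x, hx⟩ : (G ⁻¹' {c}).Nonempty := by
        by_contra hne
        rw [Set.not_nonempty_iff_eq_empty] at hne
        simp [hne] at h
      have hqpos : 0 < Q c := by
        have := hlQ x
        rw [show G x = c from hx] at this
        exact (Real.rpow_pos_of_pos (by norm_num) _).trans_le this
      refine gibbs_cell h hqpos hZ ?_
      have : ∫ x in G ⁻¹' {c}, l x ∂μ ≤ ∫ x in G ⁻¹' {c}, Real.logb 2 (Q c) ∂μ := by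
        refine setIntegral_mono_on hl.integrableOn (integrable_const _).integrableOn (hG c) ?_
        intro x hx
        rw [Real.le_logb_iff_rpow_le (by norm_num) hqpos]
        have := hlQ x
        rwa [show G x = c from hx] at this
      simpa using this
  unfold entOfObs
  rw [hint, ← Finset.sum_add_distrib]
  refine (Finset.sum_le_sum fun c _ => hcell c).trans ?_
  rw [Finset.sum_add_distrib, ← Finset.sum_mul, hone, ← Finset.sum_div, Finset.sum_sub_distrib,
    hone, ← Finset.sum_div, one_mul]
  have h1 : (∑ c, Q c) / Z ≤ 1 := (div_le_one hZ).2 hQZ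
  have : ((∑ c, Q c) / Z - 1) / Real.log 2 ≤ 0 :=
    div_nonpos_of_nonpos_of_nonneg (by linarith) hl2.le
  linarith

/-! ### Approximation by local observables -/

lemma isSetAlgebra_measurableCylinders_bool :
    IsSetAlgebra (measurableCylinders fun _ : ℤ => Bool) where
  empty_mem := empty_mem_measurableCylinders _
  compl_mem _ hs := compl_mem_measurableCylinders hs
  union_mem _ _ hs ht := union_mem_measurableCylinders hs ht

lemma exists_radius_of_mem_measurableCylinders {s : Set Bin}
    (hs : s ∈ measurableCylinders fun _ : ℤ => Bool) :
    ∃ m : ℕ, ∀ x y : Bin, (∀ i : ℤ, i.natAbs ≤ m → x i = y i) → (x ∈ s ↔ y ∈ s) := by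
  obtain ⟨I, S, -, rfl⟩ := (mem_measurableCylinders _).1 hs
  refine ⟨I.sup Int.natAbs, fun x y hxy => ?_⟩
  have : I.restrict x = I.restrict y := by
    ext i
    exact hxy _ (Finset.le_sup (f := Int.natAbs) i.2)
  rw [mem_cylinder, mem_cylinder, this]

lemma exists_local_approx (μ : Measure Bin) [IsProbabilityMeasure μ] {k : ℕ} {f : Bin → Fin k}
    (hf : Measurable f) {ε : ℝ} (hε : 0 < ε) :
    ∃ (m : ℕ) (g : Bin → Fin k),
      (∀ x y : Bin, (∀ i : ℤ, i.natAbs ≤ m → x i = y i) → g x = g y) ∧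
      μ.real {x | f x ≠ g x} ≤ ε := by
  classical
  have a₀ : Fin k := f fun _ => false
  have hk : 0 < (k : ℝ) := Nat.cast_pos.2 a₀.pos
  have hd := Measure.MeasureDense.of_generateFrom_isSetAlgebra_finite (μ := μ)
    isSetAlgebra_measurableCylinders_bool generateFrom_measurableCylinders.symm
  have happ : ∀ a : Fin k, ∃ t ∈ measurableCylinders fun _ : ℤ => Bool,
      μ (symmDiff (f ⁻¹' {a}) t) < ENNReal.ofReal (ε / k) := fun a =>
    hd.approx _ (hf (measurableSet_singleton a)) (measure_ne_top _ _) _ (by positivity)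
  choose C hC hCμ using happ
  choose r hr using fun a => exists_radius_of_mem_measurableCylinders (hC a)
  refine ⟨Finset.univ.sup r, fun x => if h : ∃ a, x ∈ C a then h.choose else a₀, ?_, ?_⟩
  · intro x y hxy
    have : ∀ a, x ∈ C a ↔ y ∈ C a := fun a =>
      hr a x y fun i hi => hxy i (hi.trans (Finset.le_sup (Finset.mem_univ a)))
    simp only [this]
  · have hsub : {x | f x ≠ if h : ∃ a, x ∈ C a then h.choose else a₀} ⊆
        ⋃ a, symmDiff (f ⁻¹' {a}) (C a) := by
      intro x hx
      rw [Set.mem_iUnion]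
      by_contra! hno
      have hiff : ∀ a, f x = a ↔ x ∈ C a := by
        intro a
        have := hno a
        rw [Set.mem_symmDiff] at this
        simp only [Set.mem_preimage, Set.mem_singleton_iff] at this
        tauto
      have hex : ∃ a, x ∈ C a := ⟨f x, (hiff _).1 rfl⟩
      apply hx
      rw [dif_pos hex]
      exact (hiff _).2 hex.choose_spec
    calc _ ≤ μ.real (⋃ a, symmDiff (f ⁻¹' {a}) (C a)) := measureReal_mono hsub
      _ ≤ ∑ a, μ.real (symmDiff (f ⁻¹' {a}) (C a)) := measureReal_iUnion_fintype_le _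
      _ ≤ ∑ a : Fin k, ε / k := by
          refine Finset.sum_le_sum fun a _ => ?_
          exact ENNReal.toReal_le_of_le_ofReal (by positivity) (hCμ a).le
      _ = ε := by
          simp
          field_simp

/-! ### The entropy bound -/

lemma shift_iterate_apply (x : Bin) (n : ℕ) (i : ℤ) : shift^[n] x i = x (i + n) := by
  induction n generalizing x i with
  | zero => simp
  | succ n ih =>
    rw [Function.iterate_succ_apply, ih]
    simp only [shift]
    congr 1
    push_cast
    ring

lemma entOfObs_comp {X F : Type*} [MeasurableSpace X] [Fintype F] {μ : Measure X}
    {S : X → X} (hS : MeasurePreserving S μ μ) {f : X → F}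
    (hf : ∀ a, MeasurableSet (f ⁻¹' {a})) : entOfObs μ (fun x => f (S x)) = entOfObs μ f := by
  unfold entOfObs
  refine Finset.sum_congr rfl fun a _ => ?_
  have : (fun x => f (S x)) ⁻¹' {a} = S ⁻¹' (f ⁻¹' {a}) := rfl
  rw [this, hS.measure_preimage (hf a).nullMeasurableSet]

lemma measurable_of_local {A : Type*} [MeasurableSpace A] {m : ℕ} {g : Bin → A}
    (hg : ∀ x y : Bin, (∀ i : ℤ, i.natAbs ≤ m → x i = y i) → g x = g y) : Measurable g := by
  intro s _
  refine IsOpen.measurableSet ?_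
  rw [isOpen_iff_forall_mem_open]
  intro x hx
  refine ⟨{y | ∀ i : ℤ, i.natAbs < m + 1 → y i = x i}, fun y hy => ?_,
    isOpen_agreeing (m + 1) x, fun i _ => rfl⟩
  have : g y = g x := hg y x fun i hi => hy i (by omega)
  simpa [this] using hx

/-- The transition weights comparing an observable with its approximation. -/
def errWeight {k : ℕ} (ε : ℝ) (a c : Fin k) : ℝ := if a = c then 1 - ε else ε / k

lemma errWeight_pos {k : ℕ} {ε : ℝ} (h0 : 0 < ε) (h1 : ε < 1) (a c : Fin k) :
    0 < errWeight ε a c := by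
  have : 0 < (k : ℝ) := Nat.cast_pos.2 a.pos
  unfold errWeight
  split_ifs
  · linarith
  · positivity

lemma sum_errWeight_le_one {k : ℕ} {ε : ℝ} (h0 : 0 < ε) (c : Fin k) :
    ∑ a, errWeight ε a c ≤ 1 := by
  have hk : 0 < (k : ℝ) := Nat.cast_pos.2 c.pos
  calc ∑ a, errWeight ε a c ≤ ∑ a : Fin k, ((if a = c then 1 - ε else 0) + ε / k) := by
        refine Finset.sum_le_sum fun a _ => ?_
        unfold errWeight
        have : 0 < ε / k := by positivity
        split_ifs <;> linarith
    _ = 1 := by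
        rw [Finset.sum_add_distrib, Finset.sum_ite_eq' Finset.univ c]
        simp
        field_simp
        ring

lemma sum_prod_errWeight_le_one {k N : ℕ} {ε : ℝ} (h0 : 0 < ε) (h1 : ε < 1) (c : Fin N → Fin k) :
    ∑ a : Fin N → Fin k, ∏ i, errWeight ε (a i) (c i) ≤ 1 := by
  classical
  have := Finset.prod_univ_sum (fun _ : Fin N => (Finset.univ : Finset (Fin k)))
    (fun i a => errWeight ε a (c i))
  rw [Fintype.piFinset_univ] at this
  rw [← this]
  exact Finset.prod_le_one (fun i _ => Finset.sum_nonneg fun a _ => (errWeight_pos h0 h1 _ _).le)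
    fun i _ => sum_errWeight_le_one h0 _

/-- A point of the full shift beginning at the origin with the word `w`. -/
def extPoint {N : ℕ} (w : Fin N → Bool) : Bin := fun z => extWord w z.toNat

lemma logb_errWeight_ge {k : ℕ} {ε : ℝ} (h0 : 0 < ε) (h1 : ε < 1) (a c : Fin k) :
    Real.logb 2 (1 - ε) + (if a = c then 0 else Real.logb 2 (ε / k)) ≤
      Real.logb 2 (errWeight ε a c) := by
  unfold errWeight
  split_ifs
  · simp
  · have : Real.logb 2 (1 - ε) ≤ 0 := Real.logb_nonpos (by norm_num) (by linarith) (by linarith)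
    linarith

lemma entOfObs_iterates_le {μ : Measure Bin} (hμ : InvProb shift μ) {ψ : Bin → ℝ}
    (hψ : Integrable ψ μ) (hcost : ∀ x : Bin, CostBound x fun i => ψ fun k => x (k + i))
    {k : ℕ} {f g : Bin → Fin k} (hf : Measurable f) {m : ℕ}
    (hg : ∀ x y : Bin, (∀ i : ℤ, i.natAbs ≤ m → x i = y i) → g x = g y)
    {ε : ℝ} (h0 : 0 < ε) (h1 : ε < 1) (hfg : μ.real {x | f x ≠ g x} ≤ ε) (n : ℕ) :
    entOfObs μ (fun x => fun i : Fin (n + 1) => f (shift^[(i : ℕ)] x)) ≤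
      Real.logb 2 (512 * ((n + 1 + 2 * m : ℕ) : ℝ)) - ((n + 1 + 2 * m : ℕ) : ℝ) * ∫ x, ψ x ∂μ -
        (n + 1) * (Real.logb 2 (1 - ε) + ε * Real.logb 2 (ε / k)) := by
  classical
  have := hμ.1
  have hT : ∀ j : ℕ, MeasurePreserving shift^[j] μ μ := fun j => hμ.2.iterate j
  have hgm : Measurable g := measurable_of_local hg
  set N := n + 1 + 2 * m with hN
  set F : Bin → Fin (n + 1) → Fin k := fun x i => f (shift^[(i : ℕ) + m] x) with hFdef
  set W : Bin → Fin N → Bool := fun x j => x (j : ℕ) with hWdef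
  have hFm : Measurable F := measurable_pi_lambda _ fun i => hf.comp (hT _).measurable
  have hWm : Measurable W := measurable_pi_lambda _ fun j => measurable_pi_apply _
  have hF0 : Measurable fun x => fun i : Fin (n + 1) => f (shift^[(i : ℕ)] x) :=
    measurable_pi_lambda _ fun i => hf.comp (hT _).measurable
  have hent : entOfObs μ (fun x => fun i : Fin (n + 1) => f (shift^[(i : ℕ)] x)) =
      entOfObs μ F := by
    rw [← entOfObs_comp (hT m) fun a => hF0 (measurableSet_singleton a)]
    simp only [hFdef, Function.iterate_add_apply]
  set c : (Fin N → Bool) → Fin (n + 1) → Fin k :=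
    fun w i => g (shift^[(i : ℕ) + m] (extPoint w)) with hcdef
  have hext : ∀ (x : Bin) (j : ℕ), j < N → extWord (W x) j = x j := by
    intro x j hj
    simp [extWord, hWdef, hj]
  have hcW : ∀ x i, c (W x) i = g (shift^[(i : ℕ) + m] x) := by
    intro x i
    refine hg _ _ fun z hz => ?_
    rw [shift_iterate_apply, shift_iterate_apply]
    have hi := i.2
    obtain ⟨j, hj⟩ : ∃ j : ℕ, z + ((i : ℕ) + m : ℕ) = (j : ℤ) :=
      ⟨(z + ((i : ℕ) + m : ℕ)).toNat, by omega⟩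
    rw [hj]
    exact hext x j (by omega)
  set Q : (Fin (n + 1) → Fin k) × (Fin N → Bool) → ℝ :=
    fun p => parseWeight N (extWord p.2) * ∏ i, errWeight ε (p.1 i) (c p.2 i) with hQdef
  set l : Bin → ℝ := fun x => ∑ j ∈ Finset.range N, ψ (shift^[j] x) +
    ∑ i : Fin (n + 1), Real.logb 2 (errWeight ε (f (shift^[(i : ℕ) + m] x))
      (g (shift^[(i : ℕ) + m] x))) with hldef
  set κ : Bin → ℝ := fun x => Real.logb 2 (errWeight ε (f x) (g x)) with hκdef
  have hκm : Measurable κ := by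
    have : Measurable fun p : Fin k × Fin k => Real.logb 2 (errWeight ε p.1 p.2) :=
      measurable_of_finite _
    exact this.comp (hf.prodMk hgm)
  have hκi : Integrable κ μ := by
    obtain ⟨B, hB⟩ := (Set.toFinite (Set.range fun p : Fin k × Fin k =>
      ‖Real.logb 2 (errWeight ε p.1 p.2)‖)).bddAbove
    exact Integrable.of_bound hκm.aestronglyMeasurable B
      (ae_of_all _ fun x => hB ⟨(f x, g x), rfl⟩)
  have hψj : ∀ j, Integrable (fun x => ψ (shift^[j] x)) μ := fun j =>
    (hT j).integrable_comp_of_integrable hψ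
  have hκj : ∀ j, Integrable (fun x => κ (shift^[j] x)) μ := fun j =>
    (hT j).integrable_comp_of_integrable hκi
  have hintj : ∀ (h : Bin → ℝ), Integrable h μ → ∀ j,
      ∫ x, h (shift^[j] x) ∂μ = ∫ x, h x ∂μ := by
    intro h hh j
    have := integral_map (hT j).aemeasurable
      (f := h) (by rw [(hT j).map_eq]; exact hh.aestronglyMeasurable)
    rw [(hT j).map_eq] at this
    exact this.symm
  have hlint : Integrable l μ :=
    (integrable_finsetSum _ fun j _ => hψj j).add (integrable_finsetSum _ fun i _ => hκj _)
  have hlval : ∫ x, l x ∂μ = (N : ℝ) * ∫ x, ψ x ∂μ + (n + 1) * ∫ x, κ x ∂μ := by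
    rw [hldef, integral_add (integrable_finsetSum _ fun j _ => hψj j)
      (integrable_finsetSum _ fun i _ => hκj _), integral_finsetSum _ fun j _ => hψj j,
      integral_finsetSum _ fun i _ => hκj _]
    rw [Finset.sum_congr rfl fun j _ => hintj ψ hψ j, Finset.sum_congr rfl fun i _ => hintj κ hκi _]
    simp
  have hκlow : Real.logb 2 (1 - ε) + ε * Real.logb 2 (ε / k) ≤ ∫ x, κ x ∂μ := by
    have hk : 1 ≤ (k : ℝ) := Nat.one_le_cast.2 (f fun _ => false).pos
    have hneg : Real.logb 2 (ε / k) ≤ 0 :=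
      Real.logb_nonpos (by norm_num) (by positivity) (by
        rw [div_le_one (by linarith)]
        linarith)
    have hms : MeasurableSet {x | f x ≠ g x} := (measurableSet_eq_fun hf hgm).compl
    calc Real.logb 2 (1 - ε) + ε * Real.logb 2 (ε / k)
        ≤ Real.logb 2 (1 - ε) + μ.real {x | f x ≠ g x} * Real.logb 2 (ε / k) := by
          have := mul_le_mul_of_nonpos_right hfg hneg
          linarith
      _ = ∫ x, Real.logb 2 (1 - ε) +
            {x | f x ≠ g x}.indicator (fun _ => Real.logb 2 (ε / k)) x ∂μ := by
          rw [integral_add (integrable_const _) ((integrable_const _).indicator hms),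
            integral_indicator_const _ hms]
          simp
      _ ≤ ∫ x, κ x ∂μ := by
          refine integral_mono ((integrable_const _).add ((integrable_const _).indicator hms))
            hκi fun x => ?_
          refine le_trans (le_of_eq ?_) (logb_errWeight_ge h0 h1 (f x) (g x))
          simp [Set.indicator_apply, ite_not]
  have hN1 : 1 ≤ N := by omega
  have hQsum : ∑ p, Q p ≤ 512 * (N : ℝ) := by
    rw [Fintype.sum_prod_type_right]
    refine le_trans ?_ (wordSum_parseWeight_le N hN1)
    refine Finset.sum_le_sum fun w _ => ?_
    simp only [hQdef]
    rw [← Finset.mul_sum]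
    exact mul_le_of_le_one_right (parseWeight_nonneg _ _)
      (sum_prod_errWeight_le_one h0 h1 _)
  have hgib := gibbs_inequality μ (G := fun x => (F x, W x))
    (fun p => (hFm.prodMk hWm) (measurableSet_singleton p)) (Q := Q)
    (fun p => mul_nonneg (parseWeight_nonneg _ _)
      (Finset.prod_nonneg fun i _ => (errWeight_pos h0 h1 _ _).le))
    (Z := 512 * (N : ℝ)) (by positivity) hQsum hlint (by
      intro x
      simp only [hldef, hQdef]
      rw [Real.rpow_add (by norm_num), Real.rpow_sum_of_pos (by norm_num) _ Finset.univ]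
      refine mul_le_mul ?_ (le_of_eq ?_) (Finset.prod_nonneg fun i _ => by positivity)
        (parseWeight_nonneg _ _)
      · have := (hcost x).rpow_sum_le N hN1 0 (extWord (W x))
          (fun j hj => by rw [hext x j hj, zero_add])
        have hshift : ∀ j : ℕ, shift^[j] x = fun z => x (z + (0 + (j : ℤ))) := fun j =>
          funext fun z => by rw [shift_iterate_apply, zero_add]
        simpa only [hshift] using this
      · refine Finset.prod_congr rfl fun i _ => ?_
        rw [Real.rpow_logb (by norm_num) (by norm_num) (errWeight_pos h0 h1 _ _), hcW])
  rw [hent]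
  have hmono := entOfObs_le_prod μ (fun a => hFm (measurableSet_singleton a))
    (fun b => hWm (measurableSet_singleton b))
  rw [hlval] at hgib
  have : ((n : ℝ) + 1) * (Real.logb 2 (1 - ε) + ε * Real.logb 2 (ε / k)) ≤
      (n + 1) * ∫ x, κ x ∂μ := mul_le_mul_of_nonneg_left hκlow (by positivity)
  linarith

lemma entObsT_nonneg {X F : Type*} [MeasurableSpace X] [Fintype F] (T : X → X) (μ : Measure X)
    [IsProbabilityMeasure μ] (f : X → F) : 0 ≤ entObsT T μ f :=
  Real.iInf_nonneg fun _ => div_nonneg (entOfObs_nonneg μ _) (by positivity)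

lemma entObsT_le {X F : Type*} [MeasurableSpace X] [Fintype F] (T : X → X) (μ : Measure X)
    [IsProbabilityMeasure μ] (f : X → F) (n : ℕ) :
    entObsT T μ f ≤ entOfObs μ (fun x => fun i : Fin (n + 1) => f (T^[(i : ℕ)] x)) / (n + 1) :=
  ciInf_le ⟨0, by
    rintro _ ⟨n, rfl⟩
    exact div_nonneg (entOfObs_nonneg μ _) (by positivity)⟩ n

lemma kolSinai_nonneg {X : Type*} [MeasurableSpace X] (T : X → X) (μ : Measure X)
    [IsProbabilityMeasure μ] : 0 ≤ kolSinai T μ :=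
  Real.iSup_nonneg fun _ => Real.iSup_nonneg fun f => entObsT_nonneg T μ f.1

lemma tendsto_logb_linear_div (m : ℕ) :
    Tendsto (fun n : ℕ => Real.logb 2 (512 * ((n + 1 + 2 * m : ℕ) : ℝ)) / (n + 1)) atTop (𝓝 0) := by
  have hlog : Tendsto (fun n : ℕ => Real.log ((n : ℝ) + 1) / (n + 1)) atTop (𝓝 0) := by
    have h := Real.isLittleO_log_id_atTop.tendsto_div_nhds_zero
    exact h.comp (tendsto_atTop_add_const_right _ 1 tendsto_natCast_atTop_atTop)
  have hinv := tendsto_one_div_add_atTop_nhds_zero_nat (𝕜 := ℝ)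
  set K : ℝ := 512 * (1 + 2 * m)
  have hub : Tendsto (fun n : ℕ => (Real.log K * (1 / ((n : ℝ) + 1)) +
      Real.log ((n : ℝ) + 1) / (n + 1)) / Real.log 2) atTop (𝓝 0) := by
    have := ((hinv.const_mul (Real.log K)).add hlog).div_const (Real.log 2)
    simpa using this
  refine squeeze_zero (fun n => ?_) (fun n => ?_) hub
  · refine div_nonneg (Real.logb_nonneg (by norm_num) ?_) (by positivity)
    push_cast
    have : (0 : ℝ) ≤ n := n.cast_nonneg
    have : (0 : ℝ) ≤ m := m.cast_nonneg
    linarith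
  · have hl2 : 0 < Real.log 2 := Real.log_pos (by norm_num)
    have hn : (0 : ℝ) ≤ n := n.cast_nonneg
    have hm : (0 : ℝ) ≤ m := m.cast_nonneg
    have hle : Real.log (512 * ((n + 1 + 2 * m : ℕ) : ℝ)) ≤
        Real.log K + Real.log ((n : ℝ) + 1) := by
      rw [← Real.log_mul (by positivity) (by positivity)]
      refine Real.log_le_log (by positivity) ?_
      push_cast
      nlinarith [mul_nonneg hm hn]
    rw [Real.logb, div_right_comm, div_le_div_iff_of_pos_right hl2, mul_one_div, ← add_div,
      div_le_div_iff_of_pos_right (by positivity)]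
    exact hle

lemma tendsto_errWeight_loss (k : ℕ) (hk : 0 < k) :
    Tendsto (fun n : ℕ => Real.logb 2 (1 - 1 / ((n : ℝ) + 2)) +
      1 / ((n : ℝ) + 2) * Real.logb 2 (1 / ((n : ℝ) + 2) / k)) atTop (𝓝 0) := by
  have hk' : (0 : ℝ) < k := Nat.cast_pos.2 hk
  have hε : Tendsto (fun n : ℕ => 1 / ((n : ℝ) + 2)) atTop (𝓝 0) := by
    have := tendsto_atTop_add_const_right _ (2 : ℝ) (tendsto_natCast_atTop_atTop (R := ℝ))
    exact this.inv_tendsto_atTop.congr fun n => (one_div _).symm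
  have h1 : Tendsto (fun t : ℝ => Real.logb 2 (1 - t) + t * Real.logb 2 (t / k)) (𝓝 0) (𝓝 0) := by
    have hc : ContinuousAt (fun t : ℝ => Real.log (1 - t) / Real.log 2 +
        k * (t / k * Real.log (t / k)) / Real.log 2) 0 := by
      refine ContinuousAt.add ?_ ?_
      · refine ContinuousAt.div_const ?_ _
        exact (by fun_prop : ContinuousAt (fun t : ℝ => 1 - t) 0).log (by norm_num)
      · refine ContinuousAt.div_const (ContinuousAt.mul continuousAt_const ?_) _
        exact (Real.continuous_mul_log.comp (continuous_id.div_const (k : ℝ))).continuousAt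
    have := hc.tendsto
    simp only [sub_zero, Real.log_one, zero_div, zero_mul, mul_zero, add_zero] at this
    refine this.congr fun t => ?_
    simp only [Real.logb]
    field_simp
  exact h1.comp hε

lemma entObsT_add_integral_nonpos {μ : Measure Bin} (hμ : InvProb shift μ) {ψ : Bin → ℝ}
    (hψ : Integrable ψ μ) (hcost : ∀ x : Bin, CostBound x fun i => ψ fun k => x (k + i))
    {k : ℕ} {f : Bin → Fin k} (hf : Measurable f) :
    entObsT shift μ f ≤ -∫ x, ψ x ∂μ := by
  have := hμ.1
  have hk : 0 < k := (f fun _ => false).pos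
  have hstep : ∀ ε : ℝ, 0 < ε → ε < 1 →
      entObsT shift μ f ≤ -∫ x, ψ x ∂μ - (Real.logb 2 (1 - ε) + ε * Real.logb 2 (ε / k)) := by
    intro ε h0 h1
    obtain ⟨m, g, hg, hfg⟩ := exists_local_approx μ hf h0
    have hlim : Tendsto (fun n : ℕ => Real.logb 2 (512 * ((n + 1 + 2 * m : ℕ) : ℝ)) / (n + 1) -
        (1 + 2 * m * (1 / ((n : ℝ) + 1))) * ∫ x, ψ x ∂μ -
        (Real.logb 2 (1 - ε) + ε * Real.logb 2 (ε / k))) atTop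
        (𝓝 (0 - (1 + 2 * m * 0) * ∫ x, ψ x ∂μ -
          (Real.logb 2 (1 - ε) + ε * Real.logb 2 (ε / k)))) :=
      ((tendsto_logb_linear_div m).sub
        (((tendsto_one_div_add_atTop_nhds_zero_nat.const_mul _).const_add _).mul_const _)).sub_const _
    have := ge_of_tendsto' hlim fun n => (entObsT_le shift μ f n).trans <| by
      rw [div_le_iff₀ (by positivity)]
      refine (entOfObs_iterates_le hμ hψ hcost hf hg h0 h1 hfg n).trans (le_of_eq ?_)
      have hn : (n : ℝ) + 1 ≠ 0 := by positivity
      push_cast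
      field_simp
    simpa using this
  have hlim := (tendsto_errWeight_loss k hk).const_sub (-∫ x, ψ x ∂μ)
  rw [sub_zero] at hlim
  refine ge_of_tendsto' hlim fun n => hstep _ (by positivity) ?_
  have : (0 : ℝ) ≤ n := n.cast_nonneg
  rw [div_lt_one (by positivity)]
  linarith

lemma kolSinai_add_integral_nonpos {μ : Measure Bin} (hμ : InvProb shift μ) {ψ : Bin → ℝ}
    (hψ : Integrable ψ μ) (hcost : ∀ x : Bin, CostBound x fun i => ψ fun k => x (k + i))
    (hnonpos : ∀ x, ψ x ≤ 0) : kolSinai shift μ + ∫ x, ψ x ∂μ ≤ 0 := by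
  have h0 : ∫ x, ψ x ∂μ ≤ 0 := integral_nonpos hnonpos
  have : kolSinai shift μ ≤ -∫ x, ψ x ∂μ :=
    Real.iSup_le (fun k => Real.iSup_le
      (fun f => entObsT_add_integral_nonpos hμ hψ hcost f.2) (by linarith)) (by linarith)
  linarith

/-! ### Mixtures of the two fixed points -/

/-- The mixture of the point masses at the two fixed points of the shift. -/
def fixedMix (t : ℝ) : Measure Bin :=
  ENNReal.ofReal t • Measure.dirac (fun _ => false : Bin) +
    ENNReal.ofReal (1 - t) • Measure.dirac (fun _ => true : Bin)

lemma measurable_shift : Measurable shift :=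
  measurable_pi_lambda _ fun _ => measurable_pi_apply _

lemma isProbabilityMeasure_fixedMix {t : ℝ} (ht : t ∈ Set.Icc (0 : ℝ) 1) :
    IsProbabilityMeasure (fixedMix t) := by
  refine ⟨?_⟩
  simp only [fixedMix, Measure.add_apply, Measure.smul_apply, measure_univ, smul_eq_mul, mul_one]
  rw [← ENNReal.ofReal_add ht.1 (by linarith [ht.2])]
  simp

lemma invProb_fixedMix {t : ℝ} (ht : t ∈ Set.Icc (0 : ℝ) 1) : InvProb shift (fixedMix t) := by
  refine ⟨isProbabilityMeasure_fixedMix ht, measurable_shift, ?_⟩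
  have h : ∀ e : Bool, shift (fun _ => e) = fun _ => e := fun _ => rfl
  rw [fixedMix, Measure.map_add _ _ measurable_shift, Measure.map_smul, Measure.map_smul,
    Measure.map_dirac' measurable_shift, Measure.map_dirac' measurable_shift, h, h]

lemma entOfObs_fixedMix_le {t : ℝ} (ht : t ∈ Set.Icc (0 : ℝ) 1) {F : Type*} [Fintype F]
    {f : Bin → F} (hf : ∀ a, MeasurableSet (f ⁻¹' {a})) :
    entOfObs (fixedMix t) f ≤ 2 / Real.log 2 := by
  classical
  have := isProbabilityMeasure_fixedMix ht
  have hl : 0 < Real.log 2 := Real.log_pos (by norm_num)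
  set S : Finset F := {f fun _ => false, f fun _ => true}
  have hsum : entOfObs (fixedMix t) f = ∑ a ∈ S,
      -((fixedMix t).real (f ⁻¹' {a}) * Real.logb 2 ((fixedMix t).real (f ⁻¹' {a}))) := by
    refine (Finset.sum_subset (Finset.subset_univ S) fun a _ ha => ?_).symm
    have h0 : f (fun _ => false) ≠ a := fun h => ha (by simp [S, h])
    have h1 : f (fun _ => true) ≠ a := fun h => ha (by simp [S, h])
    have : fixedMix t (f ⁻¹' {a}) = 0 := by
      simp [fixedMix, Measure.dirac_apply' _ (hf a), h0, h1]
    simp [this]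
  have hterm : ∀ p : ℝ, 0 ≤ p → -(p * Real.logb 2 p) ≤ 1 / Real.log 2 := by
    intro p hp
    rcases hp.eq_or_lt with rfl | hp
    · simp only [zero_mul, neg_zero]
      positivity
    · have h := mul_le_mul_of_nonneg_left (Real.one_sub_inv_le_log_of_pos hp) hp.le
      rw [mul_sub, mul_inv_cancel₀ hp.ne'] at h
      rw [Real.logb, mul_div_assoc', ← neg_div, div_le_div_iff_of_pos_right hl]
      linarith
  rw [hsum]
  refine (Finset.sum_le_card_nsmul S _ (1 / Real.log 2)
    fun a _ => hterm _ measureReal_nonneg).trans ?_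
  have hc : (S.card : ℝ) ≤ 2 := by exact_mod_cast Finset.card_le_two
  rw [nsmul_eq_mul, mul_one_div]
  exact div_le_div_of_nonneg_right hc hl.le

lemma kolSinai_fixedMix {t : ℝ} (ht : t ∈ Set.Icc (0 : ℝ) 1) :
    kolSinai shift (fixedMix t) = 0 := by
  have := isProbabilityMeasure_fixedMix ht
  refine le_antisymm ?_ (kolSinai_nonneg _ _)
  refine Real.iSup_le (fun k => Real.iSup_le (fun f => ?_) le_rfl) le_rfl
  have hlim := (tendsto_one_div_add_atTop_nhds_zero_nat (𝕜 := ℝ)).const_mul (2 / Real.log 2)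
  rw [mul_zero] at hlim
  refine ge_of_tendsto' hlim fun n => (entObsT_le shift _ f.1 n).trans ?_
  rw [mul_one_div]
  refine div_le_div_of_nonneg_right (entOfObs_fixedMix_le ht fun a => ?_) (by positivity)
  have hm : Measurable fun x => fun i : Fin (n + 1) => f.1 (shift^[(i : ℕ)] x) :=
    measurable_pi_lambda _ fun i => f.2.comp (measurable_shift.iterate _)
  exact hm (measurableSet_singleton a)

lemma integral_fixedMix_eq_zero {t : ℝ} {ψ : Bin → ℝ} (hψm : Measurable ψ)
    (hψ : ∀ e : Bool, ψ (fun _ => e) = 0) : ∫ x, ψ x ∂(fixedMix t) = 0 := by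
  have hint : ∀ e : Bool, Integrable ψ (Measure.dirac (fun _ => e : Bin)) := fun e =>
    integrable_dirac (by simp [hψ])
  rw [fixedMix, integral_add_measure ((hint _).smul_measure ENNReal.ofReal_ne_top)
    ((hint _).smul_measure ENNReal.ofReal_ne_top), integral_smul_measure, integral_smul_measure,
    integral_dirac' _ _ hψm.stronglyMeasurable, integral_dirac' _ _ hψm.stronglyMeasurable,
    hψ, hψ]
  simp

lemma eq_const_of_forall_eq_succ {x : Bin} (h : ∀ i : ℤ, x i = x (i + 1)) :
    x = fun _ => x 0 := by
  ext i
  induction i using Int.induction_on with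
  | zero => rfl
  | succ i ih => rw [← h, ih]
  | pred i ih =>
    rw [h (-(i : ℤ) - 1), sub_add_cancel, ih]

lemma eq_fixedMix_of_recurrence {μ : Measure Bin} (hμ : InvProb shift μ)
    (hrec : ∀ᵐ x ∂μ, x 0 ≠ x 1 → ∀ i : ℕ, x i ≠ x (i + 1) → i ≤ 1) :
    ∃ t : ℝ, t ∈ Set.Icc (0 : ℝ) 1 ∧ μ = fixedMix t := by
  have := hμ.1
  have hT : ∀ j : ℕ, MeasurePreserving shift^[j] μ μ := fun j => hμ.2.iterate j
  have hEm : ∀ i : ℤ, MeasurableSet {x : Bin | x i ≠ x (i + 1)} := fun i =>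
    (measurableSet_eq_fun (measurable_pi_apply i) (measurable_pi_apply (i + 1))).compl
  have hpre : ∀ (i : ℤ) (j : ℕ), shift^[j] ⁻¹' {x : Bin | x i ≠ x (i + 1)} =
      {x : Bin | x (i + j) ≠ x (i + j + 1)} := by
    intro i j
    ext x
    simp only [Set.mem_preimage, Set.mem_ofPred_eq, shift_iterate_apply]
    rw [add_right_comm]
  have hmeas : ∀ (i : ℤ) (j : ℕ), μ {x : Bin | x (i + j) ≠ x (i + j + 1)} =
      μ {x : Bin | x i ≠ x (i + 1)} := fun i j => by
    rw [← hpre, (hT j).measure_preimage (hEm i).nullMeasurableSet]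
  have hE0 : μ {x : Bin | x 0 ≠ x (0 + 1)} = 0 := by
    have hcons := hμ.2.conservative.ae_mem_imp_frequently_image_mem (hEm 0).nullMeasurableSet
    rw [measure_eq_zero_iff_ae_notMem]
    filter_upwards [hcons, hrec] with x hx hx' hmem
    obtain ⟨n, hn, hn'⟩ := frequently_atTop.1 (hx hmem) 2
    have h1 := hx' hmem n
    have : shift^[n] x 0 ≠ shift^[n] x (0 + 1) := hn'
    rw [shift_iterate_apply, shift_iterate_apply, zero_add, zero_add, add_comm (1 : ℤ)] at this
    have := h1 this
    omega
  have hE : ∀ i : ℤ, μ {x : Bin | x i ≠ x (i + 1)} = 0 := by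
    intro i
    rcases le_total 0 i with hi | hi
    · have := hmeas 0 i.toNat
      rwa [hE0, zero_add, Int.toNat_of_nonneg hi] at this
    · have := hmeas i (-i).toNat
      rw [Int.toNat_of_nonneg (by omega), add_neg_cancel] at this
      rw [← this, hE0]
  have hae : ∀ᵐ x ∂μ, x ∈ ({fun _ => false} ∪ {fun _ => true} : Set Bin) := by
    have : ∀ᵐ x ∂μ, ∀ i : ℤ, x i = x (i + 1) := by
      rw [ae_all_iff]
      intro i
      rw [ae_iff]
      exact hE i
    filter_upwards [this] with x hx
    have hc := eq_const_of_forall_eq_succ hx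
    rcases h : x 0 with _ | _ <;> rw [h] at hc <;> simp [hc]
  have hdisj : Disjoint ({fun _ => false} : Set Bin) {fun _ => true} := by
    rw [Set.disjoint_singleton]
    intro h
    exact absurd (congrFun h 0) (by simp)
  have hμeq : μ = μ {fun _ => false} • Measure.dirac (fun _ => false : Bin) +
      μ {fun _ => true} • Measure.dirac (fun _ => true : Bin) := by
    rw [← Measure.restrict_singleton, ← Measure.restrict_singleton,
      ← Measure.restrict_union hdisj (measurableSet_singleton _),
      Measure.restrict_eq_self_of_ae_mem hae]
  have htot : μ.real {fun _ => false} + μ.real {fun _ => true} = 1 := by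
    rw [← measureReal_union hdisj (measurableSet_singleton _), ← probReal_univ (μ := μ)]
    exact measureReal_congr (eventuallyEq_univ.2 hae)
  refine ⟨μ.real {fun _ => false}, ⟨measureReal_nonneg, measureReal_le_one⟩, ?_⟩
  rw [fixedMix, ← htot, add_sub_cancel_left, ofReal_measureReal, ofReal_measureReal]
  exact hμeq

/-! ### Pressure and equilibrium states at low temperature -/

section LowTemperature

variable {α : ℝ} {β : ℕ → ℝ} {b : ℝ}

lemma kolSinai_add_integral_phi_nonpos (hα : 0 < α) (hge : ∀ n : ℕ, 1 ≤ n → α ≤ β n)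
    (hb : ∀ n : ℕ, 1 ≤ n → β n ≤ b) {μ : Measure Bin} (hμ : InvProb shift μ) :
    kolSinai shift μ + ∫ x, b * phi α (cseq β) x ∂μ ≤ 0 := by
  have := hμ.1
  have hb0 : 0 ≤ b := hα.le.trans ((hge 1 le_rfl).trans (hb 1 le_rfl))
  exact kolSinai_add_integral_nonpos hμ ((integrable_phi hα hge μ).const_mul b)
    (phi_costBound hα hge hb) fun x => mul_nonpos_of_nonneg_of_nonpos hb0 (phi_nonpos hα hge x)

lemma kolSinai_add_integral_fixedMix (hα : 0 < α) (hge : ∀ n : ℕ, 1 ≤ n → α ≤ β n)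
    {t : ℝ} (ht : t ∈ Set.Icc (0 : ℝ) 1) :
    kolSinai shift (fixedMix t) + ∫ x, b * phi α (cseq β) x ∂(fixedMix t) = 0 := by
  rw [kolSinai_fixedMix ht, integral_fixedMix_eq_zero ((measurable_phi α _).const_mul b)
    (fun e => by rw [phi_const hα hge e, mul_zero]), add_zero]

lemma pressure_eq_zero (hα : 0 < α) (hge : ∀ n : ℕ, 1 ≤ n → α ≤ β n)
    (hb : ∀ n : ℕ, 1 ≤ n → β n ≤ b) : pressure shift (fun x => b * phi α (cseq β) x) = 0 := by
  refine le_antisymm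
    (Real.iSup_le (fun μ => kolSinai_add_integral_phi_nonpos hα hge hb μ.2) le_rfl) ?_
  have h01 : (0 : ℝ) ∈ Set.Icc (0 : ℝ) 1 := ⟨le_rfl, zero_le_one⟩
  rw [← kolSinai_add_integral_fixedMix (b := b) hα hge h01]
  refine le_ciSup (f := fun μ : {μ : Measure Bin // InvProb shift μ} =>
    kolSinai shift μ.1 + ∫ x, b * phi α (cseq β) x ∂μ.1) ⟨0, ?_⟩ ⟨fixedMix 0, invProb_fixedMix h01⟩
  rintro _ ⟨μ, rfl⟩
  exact kolSinai_add_integral_phi_nonpos hα hge hb μ.2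

lemma ae_phi_eq_zero_of_isEquilibrium (hα : 0 < α) (hge : ∀ n : ℕ, 1 ≤ n → α ≤ β n) {b' : ℝ}
    (hb' : ∀ n : ℕ, 1 ≤ n → β n ≤ b') (hlt : b' < b) {μ : Measure Bin}
    (hμ : IsEquilibrium shift (fun x => b * phi α (cseq β) x) μ) :
    ∀ᵐ x ∂μ, phi α (cseq β) x = 0 := by
  have := hμ.1.1
  have h1 := hμ.2
  rw [pressure_eq_zero hα hge fun n hn => (hb' n hn).trans hlt.le, integral_const_mul] at h1
  have h2 := kolSinai_add_integral_phi_nonpos hα hge hb' hμ.1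
  rw [integral_const_mul] at h2
  have h3 : ∫ x, phi α (cseq β) x ∂μ ≤ 0 := integral_nonpos fun x => phi_nonpos hα hge x
  have h4 : ∫ x, -phi α (cseq β) x ∂μ = 0 := by
    rw [integral_neg]
    nlinarith
  rw [integral_eq_zero_iff_of_nonneg (fun x => neg_nonneg.2 (phi_nonpos hα hge x))
    (integrable_phi hα hge μ).neg] at h4
  filter_upwards [h4] with x hx
  exact neg_eq_zero.1 hx

end LowTemperature

/-- freezing (quasi-crystal) corollary. -/
theorem quasi_crystal (α : ℝ) (hα : 0 < α) (β : ℕ → ℝ)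
    (hmono : ∀ m n : ℕ, 1 ≤ m → m < n → β m < β n)
    (hα1 : α < β 1) (hge : ∀ n : ℕ, 1 ≤ n → α ≤ β n)
    (βinf : ℝ) (hlim : Tendsto β atTop (𝓝 βinf))
    (b : ℝ) (hb : βinf < b) :
    {μ : Measure Bin | IsEquilibrium shift (fun x => b * phi α (cseq β) x) μ} =
      {μ : Measure Bin | ∃ t : ℝ, t ∈ Set.Icc (0 : ℝ) 1 ∧
        μ = ENNReal.ofReal t • Measure.dirac (fun _ => false : Bin) +
            ENNReal.ofReal (1 - t) • Measure.dirac (fun _ => true : Bin)} := by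
  have hβ : ∀ n : ℕ, 1 ≤ n → β n ≤ βinf := fun n hn =>
    ge_of_tendsto hlim ((eventually_gt_atTop n).mono fun m hm => (hmono n m hn hm).le)
  have hβb : ∀ n : ℕ, 1 ≤ n → β n ≤ b := fun n hn => (hβ n hn).trans hb.le
  ext μ
  constructor
  · intro hμ
    refine eq_fixedMix_of_recurrence hμ.1 ?_
    filter_upwards [ae_phi_eq_zero_of_isEquilibrium hα hge hβ hb hμ] with x hx h0 i hi
    exact le_one_of_phi_eq_zero hα hge hβ hx h0 hi
  · rintro ⟨t, ht, rfl⟩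
    refine ⟨invProb_fixedMix ht, ?_⟩
    rw [pressure_eq_zero hα hge hβb]
    exact kolSinai_add_integral_fixedMix hα hge ht

end PhaseTransitions
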